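/- arXiv:1511.09343 — 4 statements merged into one kernel-verified Lean document; each statement's English description precedes it below -/
import Mathlib

section
/- Let (ν_n, v_{1,n}, v_{2,n}, λ_{1,n}, λ_{2,n}) be a sequence of nontrivial solutions of the one-dimensional system such that for some k ∈ ℕ every component v_{i,n} has at most k critical points in (0,1), ν_n → 0, and max_{[0,1]}(v_{1,n} + v_{2,n}) → +∞ as n → ∞. Then there exist an index i ∈ {1,2} and a subsequence along which λ_{i,n} → 0 and ‖v_{i,n}‖_∞ → +∞. -/
open Set Filter MeasureTheory

/-- Assumptions on the interaction functions `g`: `C²` on `[0,∞)`, strictly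
increasing there, and `Cg⁻¹ s ≤ g s ≤ Cg s` for all `s ≥ 0`. -/
def GAss (Cg : ℝ) (g : ℝ → ℝ) : Prop :=
  ContDiffOn ℝ 2 g (Set.Ici 0) ∧ StrictMonoOn g (Set.Ici 0) ∧
    ∀ s : ℝ, 0 ≤ s → Cg⁻¹ * s ≤ g s ∧ g s ≤ Cg * s

/-- A solution of the one-dimensional system with viscosity `ν`:
`v₁, v₂` twice continuously differentiable, satisfying the ODEs on `[0,1]`,
positive on `[0,1]`, with Neumann boundary conditions and unit `L²` mass. -/
def IsSolution (ν : ℝ) (g₁ g₂ v₁ v₂ : ℝ → ℝ) (l₁ l₂ : ℝ) : Prop :=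
  ContDiff ℝ 2 v₁ ∧ ContDiff ℝ 2 v₂ ∧
    (∀ x ∈ Set.Icc (0:ℝ) 1,
      -ν * deriv (deriv v₁) x + g₁ ((v₂ x) ^ 2) * v₁ x = l₁ * v₁ x) ∧
    (∀ x ∈ Set.Icc (0:ℝ) 1,
      -ν * deriv (deriv v₂) x + g₂ ((v₁ x) ^ 2) * v₂ x = l₂ * v₂ x) ∧
    (∀ x ∈ Set.Icc (0:ℝ) 1, 0 < v₁ x) ∧
    (∀ x ∈ Set.Icc (0:ℝ) 1, 0 < v₂ x) ∧
    deriv v₁ 0 = 0 ∧ deriv v₁ 1 = 0 ∧ deriv v₂ 0 = 0 ∧ deriv v₂ 1 = 0 ∧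
    (∫ x in (0:ℝ)..1, (v₁ x) ^ 2) = 1 ∧ (∫ x in (0:ℝ)..1, (v₂ x) ^ 2) = 1

/-- The trivial (constant) solution: `v₁ ≡ v₂ ≡ 1` on `[0,1]`. -/
def IsTrivialSol (v₁ v₂ : ℝ → ℝ) : Prop :=
  ∀ x ∈ Set.Icc (0:ℝ) 1, v₁ x = 1 ∧ v₂ x = 1


lemma mvt_lb {f f' : ℝ → ℝ} {a b m : ℝ} (hab : a ≤ b)
    (hd : ∀ x ∈ Icc a b, HasDerivAt f (f' x) x) (h : ∀ x ∈ Icc a b, m ≤ f' x) :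
    m * (b - a) ≤ f b - f a := by
  refine Convex.mul_sub_le_image_sub_of_le_deriv (convex_Icc a b)
    (fun x hx => (hd x hx).continuousAt.continuousWithinAt)
    (fun x hx => (hd x (interior_subset hx)).differentiableAt.differentiableWithinAt)
    (fun x hx => ?_) a (left_mem_Icc.2 hab) b (right_mem_Icc.2 hab) hab
  rw [(hd x (interior_subset hx)).deriv]
  exact h x (interior_subset hx)

lemma mvt_ub {f f' : ℝ → ℝ} {a b m : ℝ} (hab : a ≤ b)
    (hd : ∀ x ∈ Icc a b, HasDerivAt f (f' x) x) (h : ∀ x ∈ Icc a b, f' x ≤ m) :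
    f b - f a ≤ m * (b - a) := by
  have := mvt_lb (f := fun x => - f x) (f' := fun x => - f' x) (m := -m) hab
    (fun x hx => (hd x hx).neg) (fun x hx => neg_le_neg (h x hx))
  linarith

lemma sturm {f d e : ℝ → ℝ} {a b κ : ℝ} (hκ : 0 < κ) (hb : b = a + Real.pi / √κ)
    (hf : ∀ x ∈ Icc a b, HasDerivAt f (d x) x) (hd : ∀ x ∈ Icc a b, HasDerivAt d (e x) x)
    (he : ∀ x ∈ Icc a b, e x ≤ -κ * f x) (hpos : ∀ x ∈ Icc a b, 0 < f x) : False := by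
  have hs : 0 < √κ := Real.sqrt_pos.2 hκ
  have hss : √κ * √κ = κ := Real.mul_self_sqrt hκ.le
  have hab : a ≤ b := by rw [hb]; have := Real.pi_pos; linarith [div_pos this hs]
  have hlin : ∀ x, HasDerivAt (fun x : ℝ => √κ * (x - a)) (√κ) x := by
    intro x
    simpa using ((hasDerivAt_id x).sub_const a).const_mul (√κ)
  have key := mvt_ub (f := fun x => d x * Real.sin (√κ * (x - a)) -
      f x * (√κ * Real.cos (√κ * (x - a))))
      (f' := fun x => (e x + κ * f x) * Real.sin (√κ * (x - a))) (m := 0) hab ?_ ?_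
  · have hpi : √κ * (b - a) = Real.pi := by rw [hb]; field_simp; ring
    simp only [hpi, sub_self, mul_zero, Real.sin_pi, Real.cos_pi, Real.sin_zero, Real.cos_zero] at key
    have h1 := hpos a (left_mem_Icc.2 hab)
    have h2 := hpos b (right_mem_Icc.2 hab)
    nlinarith [mul_pos h1 hs, mul_pos h2 hs]
  · intro x hx
    have h1 := ((hd x hx).mul ((hlin x).sin)).sub ((hf x hx).mul (((hlin x).cos).const_mul (√κ)))
    refine h1.congr_deriv ?_
    linear_combination (f x * Real.sin (√κ * (x - a))) * hss
  · intro x hx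
    have hsin : 0 ≤ Real.sin (√κ * (x - a)) := by
      apply Real.sin_nonneg_of_nonneg_of_le_pi
      · exact mul_nonneg hs.le (by linarith [hx.1])
      · calc √κ * (x - a) ≤ √κ * (b - a) := by
              apply mul_le_mul_of_nonneg_left _ hs.le; linarith [hx.2]
          _ = Real.pi := by rw [hb]; field_simp; ring
    exact mul_nonpos_of_nonpos_of_nonneg (by linarith [he x hx]) hsin

/-- convex and bounded above near `-∞` implies nondecreasing -/
lemma cvx_mono {F D E : ℝ → ℝ} {r C : ℝ} (hF : ∀ y < -r, HasDerivAt F (D y) y)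
    (hD : ∀ y < -r, HasDerivAt D (E y) y) (hE : ∀ y < -r, 0 ≤ E y)
    (hC : ∀ y < -r, F y ≤ C) : ∀ y < -r, 0 ≤ D y := by
  intro y hy
  by_contra hneg
  push Not at hneg
  have hle : ∀ x ≤ y, D x ≤ D y := by
    intro x hx
    have := mvt_lb (f := D) (f' := E) (m := 0) hx (fun z hz => hD z (by linarith [hz.2]))
      (fun z hz => hE z (by linarith [hz.2]))
    linarith
  set t := (C - F y + 1) / (- D y) with ht
  have hC' := hC y hy
  have htpos : 0 < t := div_pos (by linarith) (by linarith)
  have := mvt_ub (f := F) (f' := D) (m := D y) (a := y - t) (b := y) (by linarith)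
    (fun z hz => hF z (by linarith [hz.2])) (fun z hz => hle z hz.2)
  have h2 : t * (- D y) = C - F y + 1 := by rw [ht]; exact div_mul_cancel₀ _ (by linarith)
  have h3 := hC (y - t) (by linarith)
  nlinarith

lemma cvx_anti {F D E : ℝ → ℝ} {r C : ℝ} (hF : ∀ y < -r, HasDerivAt F (D y) y)
    (hD : ∀ y < -r, HasDerivAt D (E y) y) (hE : ∀ y < -r, E y ≤ 0)
    (hC : ∀ y < -r, C ≤ F y) : ∀ y < -r, D y ≤ 0 := by
  intro y hy
  have := cvx_mono (F := fun y => - F y) (D := fun y => - D y) (E := fun y => - E y) (r := r)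
    (C := -C) (fun y hy => (hF y hy).neg) (fun y hy => (hD y hy).neg)
    (fun y hy => by linarith [hE y hy]) (fun y hy => by linarith [hC y hy]) y hy
  linarith

/-- bounded functions: second derivative cannot have a positive limit at `-∞` -/
lemma lim_snd_le {F D E : ℝ → ℝ} {r C B : ℝ} (hF : ∀ y < -r, HasDerivAt F (D y) y)
    (hD : ∀ y < -r, HasDerivAt D (E y) y) (hC : ∀ y < -r, F y ≤ C)
    (hB : Tendsto E atBot (nhds B)) : B ≤ 0 := by
  by_contra hpos
  push Not at hpos
  have h1 : ∀ᶠ y in atBot, B / 2 < E y := hB.eventually (lt_mem_nhds (by linarith))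
  obtain ⟨s, hs⟩ := eventually_atBot.1 h1
  set q := max r (-s) with hq
  have hqr : r ≤ q := le_max_left _ _
  have hqs : -s ≤ q := le_max_right _ _
  have hD0 := cvx_mono (r := q) (C := C) (fun y hy => hF y (by linarith))
    (fun y hy => hD y (by linarith))
    (fun y hy => by linarith [hs y (by linarith)]) (fun y hy => hC y (by linarith))
  set y0 := -q - 1 with hy0
  set t := (D y0 + 1) / (B / 2) with ht
  have hDy := hD0 y0 (by linarith)
  have htpos : 0 < t := div_pos (by linarith) (by linarith)
  have := mvt_lb (f := D) (f' := E) (m := B / 2) (a := y0 - t) (b := y0) (by linarith)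
    (fun z hz => hD z (by linarith [hz.2])) (fun z hz => (hs z (by linarith [hz.2])).le)
  have h2 : (B / 2) * t = D y0 + 1 := by rw [ht]; field_simp
  have h3 := hD0 (y0 - t) (by linarith)
  nlinarith

lemma lim_snd {F D E : ℝ → ℝ} {r C c B : ℝ} (hF : ∀ y < -r, HasDerivAt F (D y) y)
    (hD : ∀ y < -r, HasDerivAt D (E y) y) (hC : ∀ y < -r, F y ≤ C) (hc : ∀ y < -r, c ≤ F y)
    (hB : Tendsto E atBot (nhds B)) : B = 0 := by
  apply le_antisymm (lim_snd_le hF hD hC hB)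
  have := lim_snd_le (F := fun y => - F y) (D := fun y => - D y) (E := fun y => - E y) (r := r)
    (C := -c) (fun y hy => (hF y hy).neg) (fun y hy => (hD y hy).neg)
    (fun y hy => by linarith [hc y hy]) hB.neg
  linarith

lemma gron {F1 D1 F2 D2 A1 A2 : ℝ → ℝ} {a b K y0 : ℝ} (hy0 : y0 < 0) (hK : 0 ≤ K)
    (f1 : ∀ y < 0, HasDerivAt F1 (D1 y) y) (f2 : ∀ y < 0, HasDerivAt F2 (D2 y) y)
    (d1 : ∀ y < 0, HasDerivAt D1 (A1 y) y) (d2 : ∀ y < 0, HasDerivAt D2 (A2 y) y)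
    (hA1 : ∀ y < 0, |A1 y| ≤ K * (|F1 y - a| + |F2 y - b|))
    (hA2 : ∀ y < 0, |A2 y| ≤ K * (|F1 y - a| + |F2 y - b|))
    (c1 : Tendsto F1 (nhdsWithin 0 (Iio 0)) (nhds (F1 0)))
    (c2 : Tendsto F2 (nhdsWithin 0 (Iio 0)) (nhds (F2 0)))
    (e1 : F1 y0 = a) (e2 : F2 y0 = b) (e3 : D1 y0 = 0) (e4 : D2 y0 = 0) :
    F1 0 = a ∧ F2 0 = b := by
  set c := 1 + 2 * K with hc
  set E : ℝ → ℝ := fun y => (F1 y - a)^2 + (F2 y - b)^2 + D1 y ^ 2 + D2 y ^ 2 with hE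
  have hEd : ∀ y < 0, HasDerivAt E (2 * (F1 y - a) * D1 y + 2 * (F2 y - b) * D2 y
      + 2 * D1 y * A1 y + 2 * D2 y * A2 y) y := by
    intro y hy
    have := (((((f1 y hy).sub_const a).pow 2).add (((f2 y hy).sub_const b).pow 2)).add
      ((d1 y hy).pow 2)).add ((d2 y hy).pow 2)
    refine this.congr_deriv ?_
    push_cast; ring
  have hle : ∀ y < 0, 2 * (F1 y - a) * D1 y + 2 * (F2 y - b) * D2 y
      + 2 * D1 y * A1 y + 2 * D2 y * A2 y ≤ c * E y := by
    intro y hy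
    have h1 := hA1 y hy
    have h2 := hA2 y hy
    have e1 : (F1 y - a) * D1 y ≤ |F1 y - a| * |D1 y| := by rw [← abs_mul]; exact le_abs_self _
    have e2 : (F2 y - b) * D2 y ≤ |F2 y - b| * |D2 y| := by rw [← abs_mul]; exact le_abs_self _
    have e3 : D1 y * A1 y ≤ |D1 y| * (K * (|F1 y - a| + |F2 y - b|)) := by
      calc D1 y * A1 y ≤ |D1 y| * |A1 y| := by rw [← abs_mul]; exact le_abs_self _
        _ ≤ _ := mul_le_mul_of_nonneg_left h1 (abs_nonneg _)
    have e4 : D2 y * A2 y ≤ |D2 y| * (K * (|F1 y - a| + |F2 y - b|)) := by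
      calc D2 y * A2 y ≤ |D2 y| * |A2 y| := by rw [← abs_mul]; exact le_abs_self _
        _ ≤ _ := mul_le_mul_of_nonneg_left h2 (abs_nonneg _)
    simp only [hE, hc]
    rw [← sq_abs (F1 y - a), ← sq_abs (F2 y - b), ← sq_abs (D1 y), ← sq_abs (D2 y)]
    generalize |F1 y - a| = p at *
    generalize |F2 y - b| = q at *
    generalize |D1 y| = u at *
    generalize |D2 y| = w at *
    nlinarith [mul_nonneg hK (sq_nonneg (u - p)), mul_nonneg hK (sq_nonneg (u - q)),
      mul_nonneg hK (sq_nonneg (w - p)), mul_nonneg hK (sq_nonneg (w - q)),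
      sq_nonneg (u - p), sq_nonneg (w - q)]
  have hE0 : E y0 = 0 := by simp [hE, e1, e2, e3, e4]
  have hEz : ∀ y, y0 ≤ y → y < 0 → E y ≤ 0 := by
    intro y hy hyn
    have hex : ∀ x, HasDerivAt (fun x : ℝ => Real.exp (-c * x)) (Real.exp (-c * x) * (-c)) x := by
      intro x
      simpa using ((hasDerivAt_id x).const_mul (-c)).exp
    have := mvt_ub (f := fun x => E x * Real.exp (-c * x)) (m := 0) hy
      (fun x hx => (hEd x (by linarith [hx.2])).mul (hex x)) (fun x hx => by
        have := hle x (by linarith [hx.2])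
        have hp := Real.exp_pos (-c * x)
        nlinarith)
    simp only [hE0] at this
    have hp := Real.exp_pos (-c * y)
    by_contra hcon
    push Not at hcon
    have := mul_pos hcon hp
    linarith
  have hF : ∀ y, y0 ≤ y → y < 0 → F1 y = a ∧ F2 y = b := by
    intro y h1 h2
    have := hEz y h1 h2
    simp only [hE] at this
    constructor
    · have : (F1 y - a)^2 ≤ 0 := by nlinarith [sq_nonneg (F2 y - b), sq_nonneg (D1 y), sq_nonneg (D2 y)]
      have := pow_eq_zero_iff (two_ne_zero) |>.1 (le_antisymm this (sq_nonneg _))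
      linarith
    · have : (F2 y - b)^2 ≤ 0 := by nlinarith [sq_nonneg (F1 y - a), sq_nonneg (D1 y), sq_nonneg (D2 y)]
      have := pow_eq_zero_iff (two_ne_zero) |>.1 (le_antisymm this (sq_nonneg _))
      linarith
  have hev : ∀ᶠ y in nhdsWithin (0:ℝ) (Iio 0), y0 ≤ y ∧ y < 0 := by
    have : Ico y0 0 ∈ nhdsWithin (0:ℝ) (Iio 0) := Ico_mem_nhdsLT hy0
    filter_upwards [this] with y hy using hy
  constructor
  · refine tendsto_nhds_unique c1 ?_
    refine tendsto_const_nhds.congr' ?_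
    filter_upwards [hev] with y hy using (hF y hy.1 hy.2).1.symm
  · refine tendsto_nhds_unique c2 ?_
    refine tendsto_const_nhds.congr' ?_
    filter_upwards [hev] with y hy using (hF y hy.1 hy.2).2.symm


/-- abstract assumptions on `h x = g (x^2)` -/
structure HAss (Cg : ℝ) (h : ℝ → ℝ) : Prop where
  cd : ContDiff ℝ 1 h
  mono : StrictMonoOn h (Ici 0)
  lb : ∀ x, Cg⁻¹ * x ^ 2 ≤ h x
  ub : ∀ x, h x ≤ Cg * x ^ 2

lemma HAss.zero {Cg : ℝ} {h : ℝ → ℝ} (H : HAss Cg h) : h 0 = 0 := by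
  have h1 := H.lb 0
  have h2 := H.ub 0
  simp at h1 h2
  linarith

lemma HAss.lip {Cg : ℝ} {h : ℝ → ℝ} (H : HAss Cg h) (C : ℝ) :
    ∃ K, 0 ≤ K ∧ ∀ x ∈ Icc 0 C, ∀ y ∈ Icc 0 C, |h x - h y| ≤ K * |x - y| := by
  obtain ⟨K, hK⟩ := H.cd.contDiffOn.exists_lipschitzOnWith (s := Icc 0 C) one_ne_zero
    (convex_Icc 0 C) isCompact_Icc
  refine ⟨K, K.2, fun x hx y hy => ?_⟩
  have := hK.dist_le_mul x hx y hy
  simpa [Real.dist_eq] using this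

structure HL (h1 h2 F1 D1 F2 D2 : ℝ → ℝ) (Λ1 Λ2 C r : ℝ) : Prop where
  r0 : 0 ≤ r
  C0 : 0 ≤ C
  f1 : ∀ y < 0, HasDerivAt F1 (D1 y) y
  f2 : ∀ y < 0, HasDerivAt F2 (D2 y) y
  d1 : ∀ y < 0, HasDerivAt D1 ((h1 (F2 y) - Λ1) * F1 y) y
  d2 : ∀ y < 0, HasDerivAt D2 ((h2 (F1 y) - Λ2) * F2 y) y
  b1 : ∀ y < 0, F1 y ∈ Icc 0 C
  b2 : ∀ y < 0, F2 y ∈ Icc 0 C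
  c1 : Tendsto F1 (nhdsWithin 0 (Iio 0)) (nhds (F1 0))
  c2 : Tendsto F2 (nhdsWithin 0 (Iio 0)) (nhds (F2 0))
  pp : ∀ y < 0, Λ1 < h1 (F2 y) → Λ2 < h2 (F1 y) → 0 < D1 y → 0 < D2 y → False
  mm : ∀ y < 0, h1 (F2 y) < Λ1 → h2 (F1 y) < Λ2 → D1 y < 0 → D2 y < 0 → False
  s1 : (∀ y < -r, 0 ≤ D1 y) ∨ (∀ y < -r, D1 y ≤ 0)
  s2 : (∀ y < -r, 0 ≤ D2 y) ∨ (∀ y < -r, D2 y ≤ 0)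

lemma HL.swap {h1 h2 F1 D1 F2 D2 : ℝ → ℝ} {Λ1 Λ2 C r : ℝ}
    (H : HL h1 h2 F1 D1 F2 D2 Λ1 Λ2 C r) : HL h2 h1 F2 D2 F1 D1 Λ2 Λ1 C r where
  r0 := H.r0
  C0 := H.C0
  f1 := H.f2
  f2 := H.f1
  d1 := H.d2
  d2 := H.d1
  b1 := H.b2
  b2 := H.b1
  c1 := H.c2
  c2 := H.c1
  pp := fun y hy a b c d => H.pp y hy b a d c
  mm := fun y hy a b c d => H.mm y hy b a d c
  s1 := H.s2
  s2 := H.s1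

lemma mono_of_D {F D : ℝ → ℝ} {r : ℝ} (hF : ∀ y < -r, HasDerivAt F (D y) y)
    (hD : ∀ y < -r, 0 ≤ D y) : ∀ x y, x ≤ y → y < -r → F x ≤ F y := by
  intro x y hxy hy
  have := mvt_lb (f := F) (f' := D) (m := 0) hxy (fun z hz => hF z (by linarith [hz.2]))
    (fun z hz => hD z (by linarith [hz.2]))
  linarith

lemma anti_of_D {F D : ℝ → ℝ} {r : ℝ} (hF : ∀ y < -r, HasDerivAt F (D y) y)
    (hD : ∀ y < -r, D y ≤ 0) : ∀ x y, x ≤ y → y < -r → F y ≤ F x := by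
  intro x y hxy hy
  have := mvt_ub (f := F) (f' := D) (m := 0) hxy (fun z hz => hF z (by linarith [hz.2]))
    (fun z hz => hD z (by linarith [hz.2]))
  linarith

lemma lim_mono {F D : ℝ → ℝ} {r c : ℝ} (hF : ∀ y < -r, HasDerivAt F (D y) y)
    (hD : ∀ y < -r, 0 ≤ D y) (hc : ∀ y < -r, c ≤ F y) :
    ∃ A, Tendsto F atBot (nhds A) ∧ ∀ y < -r, A ≤ F y := by
  have hm : Monotone (fun y => F (min y (-r-1))) := by
    intro x y hxy
    exact mono_of_D hF hD _ _ (min_le_min_right _ hxy)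
      (lt_of_le_of_lt (min_le_right _ _) (by linarith))
  have hb : BddBelow (range (fun y => F (min y (-r-1)))) := by
    refine ⟨c, ?_⟩
    rintro _ ⟨y, rfl⟩
    exact hc _ (lt_of_le_of_lt (min_le_right _ _) (by linarith))
  have ht := tendsto_atBot_ciInf hm hb
  have ht' : Tendsto F atBot (nhds (⨅ i, F (min i (-r-1)))) := by
    refine ht.congr' ?_
    filter_upwards [eventually_le_atBot (-r-1)] with y hy
    rw [min_eq_left hy]
  refine ⟨_, ht', fun y hy => ?_⟩
  refine le_of_tendsto ht' ?_
  filter_upwards [eventually_le_atBot y] with x hx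
  exact mono_of_D hF hD x y hx hy

lemma lim_anti {F D : ℝ → ℝ} {r c : ℝ} (hF : ∀ y < -r, HasDerivAt F (D y) y)
    (hD : ∀ y < -r, D y ≤ 0) (hc : ∀ y < -r, F y ≤ c) :
    ∃ A, Tendsto F atBot (nhds A) ∧ ∀ y < -r, F y ≤ A := by
  obtain ⟨A, h1, h2⟩ := lim_mono (F := fun y => - F y) (D := fun y => - D y) (c := -c) (r := r)
    (fun y hy => (hF y hy).neg) (fun y hy => by linarith [hD y hy])
    (fun y hy => by linarith [hc y hy])
  refine ⟨-A, by simpa using h1.neg, fun y hy => by linarith [h2 y hy]⟩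

/-- if `D1` vanishes near `-∞` and the limits are an equilibrium, the solution is that equilibrium -/
lemma HL.follow {Cg : ℝ} {h1 h2 F1 D1 F2 D2 : ℝ → ℝ} {Λ1 Λ2 C r A1 A2 y0 : ℝ}
    (H : HL h1 h2 F1 D1 F2 D2 Λ1 Λ2 C r) (H1 : HAss Cg h1) (H2 : HAss Cg h2)
    (hA1 : 0 < A1) (hA2 : 0 ≤ A2) (hA1C : A1 ≤ C) (hA2C : A2 ≤ C)
    (t1 : Tendsto F1 atBot (nhds A1))
    (e1 : h2 A1 = Λ2) (e2 : h1 A2 = Λ1) (hy0 : y0 < 0) (hz : ∀ y < y0, D1 y = 0) :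
    F1 0 = A1 ∧ F2 0 = A2 := by
  have hF1 : ∀ y < y0, F1 y = A1 := by
    intro y hy
    refine tendsto_nhds_unique (f := fun _ : ℝ => F1 y) (l := atBot) tendsto_const_nhds ?_
    refine t1.congr' ?_
    filter_upwards [eventually_le_atBot y] with x hx
    have h3 := mvt_lb (f := F1) (f' := D1) (m := 0) hx (fun z hz => H.f1 z (by linarith [hz.2]))
      (fun z hz' => (hz z (by linarith [hz'.2])).ge)
    have h4 := mvt_ub (f := F1) (f' := D1) (m := 0) hx (fun z hz => H.f1 z (by linarith [hz.2]))
      (fun z hz' => (hz z (by linarith [hz'.2])).le)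
    linarith
  have hF2 : ∀ y < y0, F2 y = A2 := by
    intro y hy
    have hd := H.d1 y (by linarith)
    have hd0 : HasDerivAt D1 0 y := by
      refine (hasDerivAt_const y (0:ℝ)).congr_of_eventuallyEq ?_
      filter_upwards [Iio_mem_nhds hy] with x hx using hz x hx
    have h0 := hd.unique hd0
    rw [hF1 y hy] at h0
    have h3 : h1 (F2 y) = h1 A2 := by
      rcases mul_eq_zero.1 h0 with h | h
      · linarith
      · linarith
    exact H1.mono.injOn (H.b2 y (by linarith)).1 hA2 h3
  have hD2 : ∀ y < y0, D2 y = 0 := by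
    intro y hy
    refine (H.f2 y (by linarith)).unique ?_
    refine (hasDerivAt_const y A2).congr_of_eventuallyEq ?_
    filter_upwards [Iio_mem_nhds hy] with x hx using hF2 x hx
  obtain ⟨K1, hK1, hL1⟩ := H1.lip C
  obtain ⟨K2, hK2, hL2⟩ := H2.lip C
  refine gron (y0 := y0 - 1) (K := (K1 + K2) * C) (by linarith)
    (mul_nonneg (add_nonneg hK1 hK2) H.C0) H.f1 H.f2 H.d1 H.d2 ?_ ?_ H.c1 H.c2
    (hF1 _ (by linarith)) (hF2 _ (by linarith)) (hz _ (by linarith)) (hD2 _ (by linarith))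
  · intro y hy
    have hb1 := H.b1 y hy
    have hl := hL1 (F2 y) (H.b2 y hy) A2 ⟨hA2, hA2C⟩
    rw [abs_mul, abs_of_nonneg hb1.1, ← e2]
    calc |h1 (F2 y) - h1 A2| * F1 y ≤ (K1 * |F2 y - A2|) * C :=
          mul_le_mul hl hb1.2 hb1.1 (by positivity)
      _ ≤ _ := by
          have := mul_nonneg (mul_nonneg hK2 H.C0) (abs_nonneg (F2 y - A2))
          have := mul_nonneg (mul_nonneg hK1 H.C0) (abs_nonneg (F1 y - A1))
          have := mul_nonneg (mul_nonneg hK2 H.C0) (abs_nonneg (F1 y - A1))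
          nlinarith
  · intro y hy
    have hb1 := H.b2 y hy
    have hl := hL2 (F1 y) (H.b1 y hy) A1 ⟨hA1.le, hA1C⟩
    rw [abs_mul, abs_of_nonneg hb1.1, ← e1]
    calc |h2 (F1 y) - h2 A1| * F2 y ≤ (K2 * |F1 y - A1|) * C :=
          mul_le_mul hl hb1.2 hb1.1 (by positivity)
      _ ≤ _ := by
          have := mul_nonneg (mul_nonneg hK2 H.C0) (abs_nonneg (F2 y - A2))
          have := mul_nonneg (mul_nonneg hK1 H.C0) (abs_nonneg (F1 y - A1))
          have := mul_nonneg (mul_nonneg hK1 H.C0) (abs_nonneg (F2 y - A2))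
          nlinarith

lemma HL.zero_case {Cg : ℝ} {h1 h2 F1 D1 F2 D2 : ℝ → ℝ} {Λ1 Λ2 C r : ℝ}
    (H : HL h1 h2 F1 D1 F2 D2 Λ1 Λ2 C r) (H1 : HAss Cg h1) (H2 : HAss Cg h2)
    (hL1 : 0 < Λ1) (hL2 : 0 < Λ2)
    (t1 : Tendsto F1 atBot (nhds 0)) (t2 : Tendsto F2 atBot (nhds 0)) :
    F1 0 = 0 ∧ F2 0 = 0 := by
  have aux : ∀ {h1 h2 F1 D1 F2 D2 : ℝ → ℝ} {Λ1 Λ2 : ℝ},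
      HL h1 h2 F1 D1 F2 D2 Λ1 Λ2 C r → HAss Cg h1 → 0 < Λ1 →
      Tendsto F1 atBot (nhds 0) → Tendsto F2 atBot (nhds 0) →
      ∃ s, 0 ≤ s ∧ ∀ y < -s, F1 y = 0 ∧ D1 y = 0 := by
    clear H H1 H2 hL1 hL2 t1 t2
    intro h1 h2 F1 D1 F2 D2 Λ1 Λ2 H H1 hL1 t1 t2
    have : Tendsto (fun y => h1 (F2 y)) atBot (nhds 0) := by
      have := (H1.cd.continuous.tendsto 0).comp t2
      rwa [H1.zero] at this
    obtain ⟨s', hs'⟩ := eventually_atBot.1 (this.eventually (gt_mem_nhds hL1))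
    set s := max 0 (-s')
    have hs0 : 0 ≤ s := le_max_left _ _
    have hs1 : -s' ≤ s := le_max_right _ _
    have hD := cvx_anti (F := F1) (D := D1) (r := s) (C := 0) (fun y hy => H.f1 y (by linarith))
      (fun y hy => H.d1 y (by linarith)) (fun y hy => by
        have := hs' y (by linarith)
        have := (H.b1 y (by linarith)).1
        nlinarith) (fun y hy => (H.b1 y (by linarith)).1)
    have hF : ∀ y < -s, F1 y = 0 := by
      intro y hy
      refine le_antisymm ?_ (H.b1 y (by linarith)).1
      refine ge_of_tendsto t1 ?_
      filter_upwards [eventually_le_atBot y] with x hx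
      exact anti_of_D (r := s) (fun y hy => H.f1 y (by linarith)) hD x y hx hy
    refine ⟨s, hs0, fun y hy => ⟨hF y hy, ?_⟩⟩
    refine (H.f1 y (by linarith)).unique ?_
    refine (hasDerivAt_const y (0:ℝ)).congr_of_eventuallyEq ?_
    filter_upwards [Iio_mem_nhds hy] with x hx using hF x hx
  obtain ⟨s, hs, hz⟩ := aux H H1 hL1 t1 t2
  obtain ⟨s', hs', hz'⟩ := aux H.swap H2 hL2 t2 t1
  have hbd : ∀ {h : ℝ → ℝ}, HAss Cg h → ∀ L, 0 < L → ∃ K, 0 ≤ K ∧ ∀ x ∈ Icc 0 C, |h x - L| ≤ K := by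
    intro h Hh L hL
    obtain ⟨K, hK, hl⟩ := Hh.lip C
    refine ⟨K * C + L, add_nonneg (mul_nonneg hK H.C0) hL.le, fun x hx => ?_⟩
    have := hl x hx 0 ⟨le_rfl, H.C0⟩
    rw [Hh.zero, sub_zero, sub_zero, abs_of_nonneg hx.1] at this
    calc |h x - L| ≤ |h x| + |L| := abs_sub _ _
      _ ≤ K * C + L := by
        rw [abs_of_pos hL]
        have := mul_le_mul_of_nonneg_left hx.2 hK
        linarith
  obtain ⟨K1, hK1, hb1⟩ := hbd H1 Λ1 hL1
  obtain ⟨K2, hK2, hb2⟩ := hbd H2 Λ2 hL2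
  refine gron (y0 := - s - s' - 1) (K := K1 + K2) (by linarith) (add_nonneg hK1 hK2)
    H.f1 H.f2 H.d1 H.d2 ?_ ?_ H.c1 H.c2 (hz _ (by linarith)).1 (hz' _ (by linarith)).1
    (hz _ (by linarith)).2 (hz' _ (by linarith)).2
  · intro y hy
    rw [abs_mul, sub_zero, sub_zero]
    have := mul_le_mul_of_nonneg_right (hb1 _ (H.b2 y hy)) (abs_nonneg (F1 y))
    have := mul_nonneg hK1 (abs_nonneg (F2 y))
    have := mul_nonneg hK2 (abs_nonneg (F2 y))
    have := mul_nonneg hK2 (abs_nonneg (F1 y))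
    nlinarith
  · intro y hy
    rw [abs_mul, sub_zero, sub_zero]
    have := mul_le_mul_of_nonneg_right (hb2 _ (H.b1 y hy)) (abs_nonneg (F2 y))
    have := mul_nonneg hK1 (abs_nonneg (F2 y))
    have := mul_nonneg hK1 (abs_nonneg (F1 y))
    have := mul_nonneg hK2 (abs_nonneg (F1 y))
    nlinarith

lemma HL.concl {Cg : ℝ} {h1 h2 F1 D1 F2 D2 : ℝ → ℝ} {Λ1 Λ2 C r : ℝ}
    (H : HL h1 h2 F1 D1 F2 D2 Λ1 Λ2 C r) (H1 : HAss Cg h1) (H2 : HAss Cg h2)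
    (hL1 : 0 < Λ1) (hL2 : 0 < Λ2) :
    (F1 0 = 0 ∧ F2 0 = 0) ∨ (h2 (F1 0) = Λ2 ∧ h1 (F2 0) = Λ1) := by
  have hr := H.r0
  have f1 : ∀ y < -r, HasDerivAt F1 (D1 y) y := fun y hy => H.f1 y (by linarith)
  have f2 : ∀ y < -r, HasDerivAt F2 (D2 y) y := fun y hy => H.f2 y (by linarith)
  have b1 : ∀ y < -r, F1 y ∈ Icc 0 C := fun y hy => H.b1 y (by linarith)
  have b2 : ∀ y < -r, F2 y ∈ Icc 0 C := fun y hy => H.b2 y (by linarith)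
  have d1 : ∀ y < -r, HasDerivAt D1 ((h1 (F2 y) - Λ1) * F1 y) y := fun y hy => H.d1 y (by linarith)
  have d2 : ∀ y < -r, HasDerivAt D2 ((h2 (F1 y) - Λ2) * F2 y) y := fun y hy => H.d2 y (by linarith)
  obtain ⟨A1, t1, m1⟩ : ∃ A, Tendsto F1 atBot (nhds A) ∧
      (((∀ y < -r, 0 ≤ D1 y) ∧ ∀ y < -r, A ≤ F1 y) ∨ ((∀ y < -r, D1 y ≤ 0) ∧ ∀ y < -r, F1 y ≤ A)) := by
    rcases H.s1 with h | h
    · obtain ⟨A, h1, h2⟩ := lim_mono f1 h (fun y hy => (b1 y hy).1)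
      exact ⟨A, h1, Or.inl ⟨h, h2⟩⟩
    · obtain ⟨A, h1, h2⟩ := lim_anti f1 h (fun y hy => (b1 y hy).2)
      exact ⟨A, h1, Or.inr ⟨h, h2⟩⟩
  obtain ⟨A2, t2, m2⟩ : ∃ A, Tendsto F2 atBot (nhds A) ∧
      (((∀ y < -r, 0 ≤ D2 y) ∧ ∀ y < -r, A ≤ F2 y) ∨ ((∀ y < -r, D2 y ≤ 0) ∧ ∀ y < -r, F2 y ≤ A)) := by
    rcases H.s2 with h | h
    · obtain ⟨A, h1, h2⟩ := lim_mono f2 h (fun y hy => (b2 y hy).1)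
      exact ⟨A, h1, Or.inl ⟨h, h2⟩⟩
    · obtain ⟨A, h1, h2⟩ := lim_anti f2 h (fun y hy => (b2 y hy).2)
      exact ⟨A, h1, Or.inr ⟨h, h2⟩⟩
  have hA1 : A1 ∈ Icc 0 C := by
    refine isClosed_Icc.mem_of_tendsto t1 ?_
    filter_upwards [eventually_lt_atBot (-r)] with y hy using b1 y hy
  have hA2 : A2 ∈ Icc 0 C := by
    refine isClosed_Icc.mem_of_tendsto t2 ?_
    filter_upwards [eventually_lt_atBot (-r)] with y hy using b2 y hy
  have q1 : (h1 A2 - Λ1) * A1 = 0 :=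
    lim_snd f1 d1 (fun y hy => (b1 y hy).2) (fun y hy => (b1 y hy).1)
      ((((H1.cd.continuous.tendsto A2).comp t2).sub_const Λ1).mul t1)
  have q2 : (h2 A1 - Λ2) * A2 = 0 :=
    lim_snd f2 d2 (fun y hy => (b2 y hy).2) (fun y hy => (b2 y hy).1)
      ((((H2.cd.continuous.tendsto A1).comp t1).sub_const Λ2).mul t2)
  have z1 := H1.zero
  have z2 := H2.zero
  by_cases hz : A1 = 0
  · left
    have : A2 = 0 := by
      rw [hz, z2] at q2
      rcases mul_eq_zero.1 q2 with h | h
      · linarith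
      · exact h
    subst this; subst hz
    exact H.zero_case H1 H2 hL1 hL2 t1 t2
  have hz2 : A2 ≠ 0 := by
    intro h
    rw [h, z1] at q1
    rcases mul_eq_zero.1 q1 with h | h
    · linarith
    · exact hz h
  have p1 : 0 < A1 := lt_of_le_of_ne hA1.1 (Ne.symm hz)
  have p2 : 0 < A2 := lt_of_le_of_ne hA2.1 (Ne.symm hz2)
  have e2 : h1 A2 = Λ1 := by
    rcases mul_eq_zero.1 q1 with h | h
    · linarith
    · exact absurd h hz
  have e1 : h2 A1 = Λ2 := by
    rcases mul_eq_zero.1 q2 with h | h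
    · linarith
    · exact absurd h hz2
  right
  suffices hs : F1 0 = A1 ∧ F2 0 = A2 by rw [hs.1, hs.2]; exact ⟨e1, e2⟩
  have fin1 : ∀ y0 < 0, (∀ y < y0, D1 y = 0) → F1 0 = A1 ∧ F2 0 = A2 := fun y0 h0 h =>
    H.follow H1 H2 p1 p2.le hA1.2 hA2.2 t1 e1 e2 h0 h
  have fin2 : ∀ y0 < 0, (∀ y < y0, D2 y = 0) → F1 0 = A1 ∧ F2 0 = A2 := fun y0 h0 h =>
    (H.swap.follow H2 H1 p2 p1.le hA2.2 hA1.2 t2 e2 e1 h0 h).symm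
  have mo1 := H1.mono.monotoneOn
  have mo2 := H2.mono.monotoneOn
  rcases m1 with ⟨s1, a1⟩ | ⟨s1, a1⟩ <;> rcases m2 with ⟨s2, a2⟩ | ⟨s2, a2⟩
  · -- both increasing
    have x1 : ∀ y < -r, 0 ≤ (h1 (F2 y) - Λ1) * F1 y := fun y hy =>
      mul_nonneg (by have := mo1 hA2.1 (b2 y hy).1 (a2 y hy); linarith) (b1 y hy).1
    have x2 : ∀ y < -r, 0 ≤ (h2 (F1 y) - Λ2) * F2 y := fun y hy =>
      mul_nonneg (by have := mo2 hA1.1 (b1 y hy).1 (a1 y hy); linarith) (b2 y hy).1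
    have mD1 := mono_of_D d1 x1
    have mD2 := mono_of_D d2 x2
    have hor : D1 (-r-2) ≤ 0 ∨ D2 (-r-2) ≤ 0 := by
      by_contra hcon
      push Not at hcon
      obtain ⟨k1, k2⟩ := hcon
      have g1 := mvt_lb (f := F1) (f' := D1) (m := D1 (-r-2)) (a := -r-2) (b := -r-1) (by linarith)
        (fun z hz => f1 z (by linarith [hz.2])) (fun z hz => mD1 _ _ hz.1 (by linarith [hz.2]))
      have g2 := mvt_lb (f := F2) (f' := D2) (m := D2 (-r-2)) (a := -r-2) (b := -r-1) (by linarith)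
        (fun z hz => f2 z (by linarith [hz.2])) (fun z hz => mD2 _ _ hz.1 (by linarith [hz.2]))
      have g3 := a1 (-r-2) (by linarith)
      have g4 := a2 (-r-2) (by linarith)
      refine H.pp (-r-1) (by linarith) ?_ ?_ ?_ ?_
      · rw [← e2]; exact H1.mono hA2.1 (b2 _ (by linarith)).1 (by linarith)
      · rw [← e1]; exact H2.mono hA1.1 (b1 _ (by linarith)).1 (by linarith)
      · linarith [mD1 (-r-2) (-r-1) (by linarith) (by linarith)]
      · linarith [mD2 (-r-2) (-r-1) (by linarith) (by linarith)]
    rcases hor with h | h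
    · refine fin1 (-r-2) (by linarith) (fun y hy => le_antisymm ?_ (s1 y (by linarith)))
      linarith [mD1 y (-r-2) hy.le (by linarith)]
    · refine fin2 (-r-2) (by linarith) (fun y hy => le_antisymm ?_ (s2 y (by linarith)))
      linarith [mD2 y (-r-2) hy.le (by linarith)]
  · -- F1 increasing, F2 decreasing
    have := cvx_anti f1 d1 (fun y hy => by
      have := mo1 (b2 y hy).1 hA2.1 (a2 y hy)
      have := (b1 y hy).1
      nlinarith) (fun y hy => (b1 y hy).1)
    exact fin1 (-r-1) (by linarith)
      (fun y hy => le_antisymm (this y (by linarith)) (s1 y (by linarith)))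
  · have := cvx_anti f2 d2 (fun y hy => by
      have := mo2 (b1 y hy).1 hA1.1 (a1 y hy)
      have := (b2 y hy).1
      nlinarith) (fun y hy => (b2 y hy).1)
    exact fin2 (-r-1) (by linarith)
      (fun y hy => le_antisymm (this y (by linarith)) (s2 y (by linarith)))
  · -- both decreasing
    have x1 : ∀ y < -r, (h1 (F2 y) - Λ1) * F1 y ≤ 0 := fun y hy =>
      mul_nonpos_of_nonpos_of_nonneg
        (by have := mo1 (b2 y hy).1 hA2.1 (a2 y hy); linarith) (b1 y hy).1
    have x2 : ∀ y < -r, (h2 (F1 y) - Λ2) * F2 y ≤ 0 := fun y hy =>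
      mul_nonpos_of_nonpos_of_nonneg
        (by have := mo2 (b1 y hy).1 hA1.1 (a1 y hy); linarith) (b2 y hy).1
    have mD1 := anti_of_D d1 x1
    have mD2 := anti_of_D d2 x2
    have hor : 0 ≤ D1 (-r-2) ∨ 0 ≤ D2 (-r-2) := by
      by_contra hcon
      push Not at hcon
      obtain ⟨k1, k2⟩ := hcon
      have g1 := mvt_ub (f := F1) (f' := D1) (m := D1 (-r-2)) (a := -r-2) (b := -r-1) (by linarith)
        (fun z hz => f1 z (by linarith [hz.2])) (fun z hz => mD1 _ _ hz.1 (by linarith [hz.2]))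
      have g2 := mvt_ub (f := F2) (f' := D2) (m := D2 (-r-2)) (a := -r-2) (b := -r-1) (by linarith)
        (fun z hz => f2 z (by linarith [hz.2])) (fun z hz => mD2 _ _ hz.1 (by linarith [hz.2]))
      have g3 := a1 (-r-2) (by linarith)
      have g4 := a2 (-r-2) (by linarith)
      refine H.mm (-r-1) (by linarith) ?_ ?_ ?_ ?_
      · rw [← e2]; exact H1.mono (b2 _ (by linarith)).1 hA2.1 (by linarith)
      · rw [← e1]; exact H2.mono (b1 _ (by linarith)).1 hA1.1 (by linarith)
      · linarith [mD1 (-r-2) (-r-1) (by linarith) (by linarith)]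
      · linarith [mD2 (-r-2) (-r-1) (by linarith) (by linarith)]
    rcases hor with h | h
    · refine fin1 (-r-2) (by linarith) (fun y hy => le_antisymm (s1 y (by linarith)) ?_)
      linarith [mD1 y (-r-2) hy.le (by linarith)]
    · refine fin2 (-r-2) (by linarith) (fun y hy => le_antisymm (s2 y (by linarith)) ?_)
      linarith [mD2 y (-r-2) hy.le (by linarith)]


structure Rs (k : ℕ) (h1 h2 f1 d1 f2 d2 : ℝ → ℝ) (l1 l2 C T : ℝ) : Prop where
  f1d : ∀ y, HasDerivAt f1 (d1 y) y
  f2d : ∀ y, HasDerivAt f2 (d2 y) y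
  d1d : ∀ y ∈ Icc (-T) 0, HasDerivAt d1 ((h1 (f2 y) - l1) * f1 y) y
  d2d : ∀ y ∈ Icc (-T) 0, HasDerivAt d2 ((h2 (f1 y) - l2) * f2 y) y
  b1 : ∀ y ∈ Icc (-T) 0, f1 y ∈ Icc 0 C
  b2 : ∀ y ∈ Icc (-T) 0, f2 y ∈ Icc 0 C
  cr1 : {y ∈ Ioo (-T) 0 | d1 y = 0}.Finite ∧ {y ∈ Ioo (-T) 0 | d1 y = 0}.ncard ≤ k
  cr2 : {y ∈ Ioo (-T) 0 | d2 y = 0}.Finite ∧ {y ∈ Ioo (-T) 0 | d2 y = 0}.ncard ≤ k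
  pp : ∀ y ∈ Ioo (-T) 0, l1 < h1 (f2 y) → l2 < h2 (f1 y) → 0 < d1 y → 0 < d2 y → False
  mm : ∀ y ∈ Ioo (-T) 0, h1 (f2 y) < l1 → h2 (f1 y) < l2 → d1 y < 0 → d2 y < 0 → False

lemma Rs.swap {k : ℕ} {h1 h2 f1 d1 f2 d2 : ℝ → ℝ} {l1 l2 C T : ℝ}
    (H : Rs k h1 h2 f1 d1 f2 d2 l1 l2 C T) : Rs k h2 h1 f2 d2 f1 d1 l2 l1 C T where
  f1d := H.f2d
  f2d := H.f1d
  d1d := H.d2d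
  d2d := H.d1d
  b1 := H.b2
  b2 := H.b1
  cr1 := H.cr2
  cr2 := H.cr1
  pp := fun y hy a b c d => H.pp y hy b a d c
  mm := fun y hy a b c d => H.mm y hy b a d c

lemma abs_mvt {f d : ℝ → ℝ} {a b K : ℝ} (hab : a ≤ b)
    (hd : ∀ x ∈ Icc a b, HasDerivAt f (d x) x) (h : ∀ x ∈ Icc a b, |d x| ≤ K) :
    |f b - f a| ≤ K * (b - a) := by
  rw [abs_le]
  constructor
  · have := mvt_lb (m := -K) hab hd (fun x hx => (abs_le.1 (h x hx)).1)
    linarith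
  · exact mvt_ub hab hd (fun x hx => (abs_le.1 (h x hx)).2)

lemma abs_mvt' {f d : ℝ → ℝ} {p q K : ℝ}
    (hd : ∀ x ∈ Icc p q, HasDerivAt f (d x) x) (h : ∀ x ∈ Icc p q, |d x| ≤ K)
    {y z : ℝ} (hy : y ∈ Icc p q) (hz : z ∈ Icc p q) :
    |f z - f y| ≤ K * |z - y| := by
  rcases le_total y z with hyz | hyz
  · rw [abs_of_nonneg (sub_nonneg.2 hyz)]
    exact abs_mvt hyz (fun x hx => hd x ⟨hy.1.trans hx.1, hx.2.trans hz.2⟩)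
      (fun x hx => h x ⟨hy.1.trans hx.1, hx.2.trans hz.2⟩)
  · rw [abs_sub_comm, abs_sub_comm z, abs_of_nonneg (sub_nonneg.2 hyz)]
    exact abs_mvt hyz (fun x hx => hd x ⟨hz.1.trans hx.1, hx.2.trans hy.2⟩)
      (fun x hx => h x ⟨hz.1.trans hx.1, hx.2.trans hy.2⟩)

lemma taylor {f d : ℝ → ℝ} {p q K : ℝ} (hK : 0 ≤ K)
    (hd : ∀ x ∈ Icc p q, HasDerivAt f (d x) x)
    (h : ∀ y ∈ Icc p q, ∀ z ∈ Icc p q, |d z - d y| ≤ K * |z - y|)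
    {y z : ℝ} (hy : y ∈ Icc p q) (hz : z ∈ Icc p q) :
    |f z - f y - d y * (z - y)| ≤ K * (z - y) ^ 2 := by
  have hgd : ∀ x ∈ Icc p q, HasDerivAt (fun x => f x - d y * x) (d x - d y) x := by
    intro x hx
    exact ((hd x hx).sub ((hasDerivAt_id x).const_mul (d y))).congr_deriv (by simp)
  have e : f z - f y - d y * (z - y) = (f z - d y * z) - (f y - d y * y) := by ring
  rw [e]
  rcases le_total y z with hyz | hyz
  · have := abs_mvt (f := fun x => f x - d y * x) (K := K * (z - y)) hyz
      (fun x hx => hgd x ⟨hy.1.trans hx.1, hx.2.trans hz.2⟩) (fun x hx => by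
        refine (h y hy x ⟨hy.1.trans hx.1, hx.2.trans hz.2⟩).trans ?_
        apply mul_le_mul_of_nonneg_left _ hK
        rw [abs_of_nonneg (by linarith [hx.1])]; linarith [hx.2])
    refine this.trans (le_of_eq (by ring))
  · have := abs_mvt (f := fun x => f x - d y * x) (K := K * (y - z)) hyz
      (fun x hx => hgd x ⟨hz.1.trans hx.1, hx.2.trans hy.2⟩) (fun x hx => by
        refine (h y hy x ⟨hz.1.trans hx.1, hx.2.trans hy.2⟩).trans ?_
        apply mul_le_mul_of_nonneg_left _ hK
        rw [abs_of_nonpos (by linarith [hx.2])]; linarith [hx.1])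
    rw [abs_sub_comm]
    refine this.trans (le_of_eq (by ring))

lemma hasDerivAt_of_taylor {F D : ℝ → ℝ} {K : ℝ}
    (h : ∀ y ≤ 0, ∀ z ≤ 0, |F z - F y - D y * (z - y)| ≤ K * (z - y) ^ 2) :
    ∀ y < 0, HasDerivAt F (D y) y := by
  intro y hy
  rw [hasDerivAt_iff_isLittleO]
  have h1 : (fun x' => F x' - F y - (x' - y) • D y) =O[nhds y] fun x' => ‖x' - y‖ ^ 2 := by
    refine Asymptotics.IsBigO.of_bound K ?_
    filter_upwards [Iio_mem_nhds hy] with x hx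
    have := h y hy.le x (le_of_lt hx)
    simp only [smul_eq_mul, Real.norm_eq_abs, abs_pow, abs_abs, sq_abs]
    rw [mul_comm (x - y)]
    exact this
  exact h1.trans_isLittleO (Asymptotics.isLittleO_pow_sub_sub y (by norm_num))

lemma deriv_bound {f d e : ℝ → ℝ} {T C K : ℝ} (hT : 2 ≤ T) (hK : 0 ≤ K) (hC : 0 ≤ C)
    (hd : ∀ x ∈ Icc (-T) 0, HasDerivAt f (d x) x)
    (he : ∀ x ∈ Icc (-T) 0, HasDerivAt d (e x) x)
    (hb : ∀ x ∈ Icc (-T) 0, f x ∈ Icc 0 C) (hK' : ∀ x ∈ Icc (-T) 0, |e x| ≤ K) :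
    ∀ y ∈ Icc (-T) 0, |d y| ≤ C + K := by
  intro y hy
  have main : ∀ z ∈ Icc (-T) 0, z + 1 ≤ 0 → (z = y ∨ z + 1 = y) → |d y| ≤ C + K := by
    intro z hz hz1 hzy
    have hsub : ∀ x ∈ Icc z (z+1), x ∈ Icc (-T) 0 := fun x hx => ⟨hz.1.trans hx.1, hx.2.trans hz1⟩
    have hyz : y ∈ Icc z (z+1) := by rcases hzy with h | h <;> constructor <;> linarith
    have hdd : ∀ x ∈ Icc z (z+1), |d x - d y| ≤ K := by
      intro x hx
      have := abs_mvt' he hK' hy (hsub x hx)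
      have h2 : |x - y| ≤ 1 := by
        rw [abs_le]; constructor <;> linarith [hx.1, hx.2, hyz.1, hyz.2]
      nlinarith
    have h0 := hb z (hsub z ⟨le_rfl, by linarith⟩)
    have h1 := hb (z+1) (hsub _ ⟨by linarith, le_rfl⟩)
    rw [abs_le]
    constructor
    · have := mvt_ub (f := f) (f' := d) (m := d y + K) (a := z) (b := z+1) (by linarith)
        (fun x hx => hd x (hsub x hx)) (fun x hx => by linarith [(abs_le.1 (hdd x hx)).2])
      linarith [h0.1, h0.2, h1.1, h1.2]
    · have := mvt_lb (f := f) (f' := d) (m := d y - K) (a := z) (b := z+1) (by linarith)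
        (fun x hx => hd x (hsub x hx)) (fun x hx => by linarith [(abs_le.1 (hdd x hx)).1])
      linarith [h0.1, h0.2, h1.1, h1.2]
  rcases le_total y (-1) with h | h
  · exact main y hy (by linarith) (Or.inl rfl)
  · exact main (y-1) ⟨by linarith, by linarith [hy.2]⟩ (by linarith [hy.2]) (Or.inr (by ring))

/-- uniform estimates -/
lemma Rs.unif {Cg : ℝ} {h1 h2 : ℝ → ℝ} (hCg : 0 < Cg) (H1 : HAss Cg h1) (C Lb : ℝ)
    (hC : 0 ≤ C) (hLb : 0 ≤ Lb) :
    ∃ K, 0 ≤ K ∧ ∀ (k : ℕ) (f1 d1 f2 d2 : ℝ → ℝ) (l1 l2 T : ℝ), |l1| ≤ Lb → 2 ≤ T →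
      Rs k h1 h2 f1 d1 f2 d2 l1 l2 C T → ∀ y ∈ Icc (-T) 0,
        |(h1 (f2 y) - l1) * f1 y| ≤ K ∧ |d1 y| ≤ K := by
  refine ⟨C + (Cg * C ^ 2 + Lb) * C, by positivity, ?_⟩
  intro k f1 d1 f2 d2 l1 l2 T hl hT H
  have hA : ∀ y ∈ Icc (-T) 0, |(h1 (f2 y) - l1) * f1 y| ≤ (Cg * C ^ 2 + Lb) * C := by
    intro y hy
    have hb1 := H.b1 y hy
    have hb2 := H.b2 y hy
    rw [abs_mul, abs_of_nonneg hb1.1]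
    refine mul_le_mul ?_ hb1.2 hb1.1 (by positivity)
    have u := H1.ub (f2 y)
    have l := H1.lb (f2 y)
    have l0 : 0 ≤ Cg⁻¹ * f2 y ^ 2 := by positivity
    have : f2 y ^ 2 ≤ C ^ 2 := pow_le_pow_left₀ hb2.1 hb2.2 2
    have := mul_le_mul_of_nonneg_left this hCg.le
    calc |h1 (f2 y) - l1| ≤ |h1 (f2 y)| + |l1| := abs_sub _ _
      _ ≤ _ := by rw [abs_of_nonneg (by linarith : 0 ≤ h1 (f2 y))]; linarith
  intro y hy
  refine ⟨(hA y hy).trans (by linarith), ?_⟩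
  exact deriv_bound hT (by positivity) hC (fun x _ => H.f1d x) H.d1d H.b1 hA y hy

/-- the taylor estimates for the approximants -/
lemma Rs.tay {Cg : ℝ} {h1 h2 : ℝ → ℝ} (hCg : 0 < Cg) (H1 : HAss Cg h1) (H2 : HAss Cg h2) (C Lb : ℝ)
    (hC : 0 ≤ C) (hLb : 0 ≤ Lb) :
    ∃ K, 0 ≤ K ∧ ∀ (k : ℕ) (f1 d1 f2 d2 : ℝ → ℝ) (l1 l2 T : ℝ), |l1| ≤ Lb → |l2| ≤ Lb → 2 ≤ T →
      Rs k h1 h2 f1 d1 f2 d2 l1 l2 C T → ∀ y ∈ Icc (-T) 0, |d1 y| ≤ K ∧ ∀ z ∈ Icc (-T) 0,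
        |f1 z - f1 y| ≤ K * |z - y| ∧
        |f1 z - f1 y - d1 y * (z - y)| ≤ K * (z - y) ^ 2 ∧
        |d1 z - d1 y - (h1 (f2 y) - l1) * f1 y * (z - y)| ≤ K * (z - y) ^ 2 := by
  obtain ⟨K1, hK1, u1⟩ := Rs.unif (h2 := h2) hCg H1 C Lb hC hLb
  obtain ⟨K2, hK2, u2⟩ := Rs.unif (h2 := h1) hCg H2 C Lb hC hLb
  obtain ⟨Kh, hKh, hl⟩ := H1.lip C
  set K3 := Kh * K2 * C + (Kh * C + Lb) * K1 with hK3
  have hK3p : 0 ≤ K3 := by positivity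
  refine ⟨K1 + K3, by positivity, ?_⟩
  intro k f1 d1 f2 d2 l1 l2 T hl1 hl2 hT H y hy
  have a1 := u1 k f1 d1 f2 d2 l1 l2 T hl1 hT H
  have a2 := u2 k f2 d2 f1 d1 l2 l1 T hl2 hT H.swap
  refine ⟨(a1 y hy).2.trans (by linarith), fun z hz => ⟨?_, ?_, ?_⟩⟩
  · refine (abs_mvt' (fun x _ => H.f1d x) (fun x hx => (a1 x hx).2) hy hz).trans ?_
    exact mul_le_mul_of_nonneg_right (by linarith) (abs_nonneg _)
  · refine (taylor hK1 (fun x _ => H.f1d x) (fun y hy z hz => ?_) hy hz).trans ?_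
    · exact abs_mvt' H.d1d (fun x hx => (a1 x hx).1) hy hz
    · exact mul_le_mul_of_nonneg_right (by linarith) (sq_nonneg _)
  · refine (taylor hK3p H.d1d (fun y hy z hz => ?_) hy hz).trans ?_
    · have l1' := abs_mvt' (fun x _ => H.f1d x) (fun x hx => (a1 x hx).2) hy hz
      have l2' := abs_mvt' (fun x _ => H.f2d x) (fun x hx => (a2 x hx).2) hy hz
      have hh := hl _ (H.b2 z hz) _ (H.b2 y hy)
      have hh0 := hl _ (H.b2 y hy) 0 ⟨le_rfl, hC⟩
      have b1z := H.b1 z hz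
      have b2y := H.b2 y hy
      rw [H1.zero, sub_zero, sub_zero, abs_of_nonneg b2y.1] at hh0
      have hs : |h1 (f2 y) - l1| ≤ Kh * C + Lb := by
        calc |h1 (f2 y) - l1| ≤ |h1 (f2 y)| + |l1| := abs_sub _ _
          _ ≤ _ := by linarith [mul_le_mul_of_nonneg_left b2y.2 hKh]
      have e : (h1 (f2 z) - l1) * f1 z - (h1 (f2 y) - l1) * f1 y =
          (h1 (f2 z) - h1 (f2 y)) * f1 z + (h1 (f2 y) - l1) * (f1 z - f1 y) := by ring
      rw [e]
      calc _ ≤ |(h1 (f2 z) - h1 (f2 y)) * f1 z| + |(h1 (f2 y) - l1) * (f1 z - f1 y)| := abs_add_le _ _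
        _ ≤ (Kh * (K2 * |z - y|)) * C + (Kh * C + Lb) * (K1 * |z - y|) := by
            rw [abs_mul, abs_mul, abs_of_nonneg b1z.1]
            refine add_le_add (mul_le_mul ?_ b1z.2 b1z.1 (by positivity))
              (mul_le_mul hs l1' (abs_nonneg _) (by positivity))
            exact hh.trans (mul_le_mul_of_nonneg_left l2' hKh)
        _ = _ := by rw [hK3]; ring
    · exact mul_le_mul_of_nonneg_right (by linarith) (sq_nonneg _)


lemma ultra_lim (U : Ultrafilter ℕ) {u : ℕ → ℝ} {a b : ℝ}
    (h : ∀ᶠ n in (U : Filter ℕ), u n ∈ Icc a b) : ∃ l ∈ Icc a b, Tendsto u U (nhds l) := by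
  have := (isCompact_Icc (a := a) (b := b)).ultrafilter_le_nhds (U.map u) (by
    rw [Ultrafilter.coe_map, le_principal_iff]; exact h)
  obtain ⟨l, hl, h2⟩ := this
  exact ⟨l, hl, h2⟩

/-- eventual sign of the derivative in the limit -/
lemma ultra_sign (U : Ultrafilter ℕ) (k : ℕ) (d : ℕ → ℝ → ℝ) (D : ℝ → ℝ) (T : ℕ → ℝ)
    (hT : Tendsto T U atTop)
    (hc : ∀ᶠ n in (U : Filter ℕ), ContinuousOn (d n) (Icc (-(T n)) 0))
    (hcr : ∀ᶠ n in (U : Filter ℕ), {y ∈ Ioo (-(T n)) 0 | d n y = 0}.Finite ∧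
      {y ∈ Ioo (-(T n)) 0 | d n y = 0}.ncard ≤ k)
    (hD : ∀ y ≤ 0, Tendsto (fun n => d n y) U (nhds (D y))) :
    ∃ r0, 0 ≤ r0 ∧ ∀ r ≥ r0, (∀ y < -r, 0 ≤ D y) ∨ (∀ y < -r, D y ≤ 0) := by
  set Z : ℕ → ℝ → Set ℝ := fun n s => {y | y ∈ Ioo (-s) 0 ∧ y ∈ Ioo (-(T n)) 0 ∧ d n y = 0} with hZ
  have hZfin : ∀ᶠ n in (U : Filter ℕ), ∀ s, (Z n s).Finite ∧ (Z n s).ncard ≤ k := by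
    filter_upwards [hcr] with n hn s
    have hsub : Z n s ⊆ {y ∈ Ioo (-(T n)) 0 | d n y = 0} := fun y hy => hy.2
    exact ⟨hn.1.subset hsub, (ncard_le_ncard hsub hn.1).trans hn.2⟩
  set P : ℕ → Prop := fun m => ∃ s : ℝ, 0 ≤ s ∧ ∀ᶠ n in (U : Filter ℕ), m ≤ (Z n s).ncard with hP
  have hP0 : P 0 := ⟨0, le_rfl, by simp⟩
  have hPk : ¬ P (k+1) := by
    rintro ⟨s, -, hs⟩
    obtain ⟨n, h1, h2⟩ := (hs.and hZfin).exists
    have := (h2 s).2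
    omega
  obtain ⟨m, hm, hm'⟩ : ∃ m, P m ∧ ¬ P (m+1) := by
    by_contra hcon
    push Not at hcon
    have : ∀ m, P m := fun m => Nat.rec hP0 (fun m ih => hcon m ih) m
    exact hPk (this _)
  obtain ⟨s, hs0, hs⟩ := hm
  have hempty : ∀ s' ≥ s, ∀ᶠ n in (U : Filter ℕ), ∀ y ∈ Ioo (-s') (-s), d n y ≠ 0 := by
    intro s' hss
    have h1 : ∀ᶠ n in (U : Filter ℕ), ¬ (m + 1 ≤ (Z n s').ncard) := by
      rw [Ultrafilter.eventually_not]
      exact fun h => hm' ⟨s', hs0.trans hss, h⟩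
    filter_upwards [h1, hs, hZfin, hT.eventually_ge_atTop s'] with n a1 a2 a3 a4 y hy hdy
    have hsub : Z n s ⊆ Z n s' := fun y hy => ⟨⟨by linarith [hy.1.1], hy.1.2⟩, hy.2⟩
    have heq := Set.eq_of_subset_of_ncard_le hsub (by omega) (a3 s').1
    have : y ∈ Z n s' := ⟨⟨hy.1, by linarith [hy.2]⟩, ⟨by linarith [hy.1], by linarith [hy.2]⟩, hdy⟩
    rw [← heq] at this
    linarith [this.1.1, hy.2]
  refine ⟨s, hs0, fun r hr => ?_⟩
  have hsg : ∀ s' ≥ s, ∀ᶠ n in (U : Filter ℕ), ∀ y ∈ Ioo (-s') (-s), ∀ z ∈ Ioo (-s') (-s),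
      0 < d n y → 0 ≤ d n z := by
    intro s' hs'
    filter_upwards [hempty s' hs', hc, hT.eventually_ge_atTop s'] with n a1 a2 a3 y hy z hz hdy
    by_contra hneg
    push Not at hneg
    have hsub : uIcc y z ⊆ Ioo (-s') (-s) := (ordConnected_Ioo).uIcc_subset hy hz
    have hcont : ContinuousOn (d n) (uIcc y z) := a2.mono fun x hx =>
      ⟨by linarith [(hsub hx).1], by linarith [(hsub hx).2]⟩
    have hiv := intermediate_value_uIcc hcont
    have h0 : (0:ℝ) ∈ uIcc (d n y) (d n z) := by
      rw [mem_uIcc]; right; exact ⟨hneg.le, hdy.le⟩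
    obtain ⟨x, hx, hx0⟩ := hiv h0
    exact a1 x (hsub hx) hx0
  by_cases hpos : ∀ᶠ n in (U : Filter ℕ), 0 < d n (-s-1)
  · left
    intro y hy
    refine ge_of_tendsto (hD y (by linarith)) ?_
    filter_upwards [hpos, hsg (max (s+2) (-y+1)) ((by linarith : s ≤ s+2).trans (le_max_left _ _))]
      with n h1 h2
    have m1 := le_max_left (s+2) (-y+1)
    have m2 := le_max_right (s+2) (-y+1)
    exact h2 (-s-1) ⟨by linarith, by linarith⟩ y ⟨by linarith, by linarith⟩ h1
  · right
    intro y hy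
    rw [← Ultrafilter.eventually_not] at hpos
    refine le_of_tendsto (hD y (by linarith)) ?_
    filter_upwards [hpos, hsg (max (s+2) (-y+1)) ((by linarith : s ≤ s+2).trans (le_max_left _ _)),
      hempty (s+2) (by linarith)] with n h1 h2 h3
    have m1 := le_max_left (s+2) (-y+1)
    have m2 := le_max_right (s+2) (-y+1)
    by_contra hcon
    push Not at hcon
    have h4 := h2 y ⟨by linarith, by linarith⟩ (-s-1) ⟨by linarith, by linarith⟩ hcon
    have h5 := h3 (-s-1) ⟨by linarith, by linarith⟩
    exact h1 (lt_of_le_of_ne h4 (Ne.symm h5))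

lemma core_limit (U : Ultrafilter ℕ) {Cg : ℝ} (hCg : 0 < Cg) {k : ℕ} {h1 h2 : ℝ → ℝ}
    (H1 : HAss Cg h1) (H2 : HAss Cg h2)
    {f1 d1 f2 d2 : ℕ → ℝ → ℝ} {l1 l2 T : ℕ → ℝ} {Λ1 Λ2 C : ℝ} (hC : 0 ≤ C)
    (hL1 : 0 < Λ1) (hL2 : 0 < Λ2)
    (tl1 : Tendsto l1 U (nhds Λ1)) (tl2 : Tendsto l2 U (nhds Λ2)) (hT : Tendsto T U atTop)
    (H : ∀ᶠ n in (U : Filter ℕ), Rs k h1 h2 (f1 n) (d1 n) (f2 n) (d2 n) (l1 n) (l2 n) C (T n)) :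
    ∃ V1 V2, Tendsto (fun n => f1 n 0) U (nhds V1) ∧ Tendsto (fun n => f2 n 0) U (nhds V2) ∧
      ((V1 = 0 ∧ V2 = 0) ∨ (h2 V1 = Λ2 ∧ h1 V2 = Λ1)) := by
  set Lb := Λ1 + Λ2 + 1 with hLb
  have hLb0 : 0 ≤ Lb := by linarith
  have bl1 : ∀ᶠ n in (U : Filter ℕ), |l1 n| ≤ Lb := by
    filter_upwards [tl1.eventually (Ioo_mem_nhds (by linarith : 0 < Λ1) (by linarith : Λ1 < Lb))]
      with n hn
    rw [abs_of_pos hn.1]; exact hn.2.le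
  have bl2 : ∀ᶠ n in (U : Filter ℕ), |l2 n| ≤ Lb := by
    filter_upwards [tl2.eventually (Ioo_mem_nhds (by linarith : 0 < Λ2) (by linarith : Λ2 < Lb))]
      with n hn
    rw [abs_of_pos hn.1]; exact hn.2.le
  obtain ⟨K, hK, tay1⟩ := Rs.tay hCg H1 H2 C Lb hC hLb0
  obtain ⟨K', hK', tay2⟩ := Rs.tay hCg H2 H1 C Lb hC hLb0
  have est1 : ∀ᶠ n in (U : Filter ℕ), ∀ y ∈ Icc (-(T n)) 0, |d1 n y| ≤ K ∧ ∀ z ∈ Icc (-(T n)) 0,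
        |f1 n z - f1 n y| ≤ K * |z - y| ∧
        |f1 n z - f1 n y - d1 n y * (z - y)| ≤ K * (z - y) ^ 2 ∧
        |d1 n z - d1 n y - (h1 (f2 n y) - l1 n) * f1 n y * (z - y)| ≤ K * (z - y) ^ 2 := by
    filter_upwards [H, bl1, bl2, hT.eventually_ge_atTop 2] with n a b c d
    exact tay1 k _ _ _ _ _ _ _ b c d a
  have est2 : ∀ᶠ n in (U : Filter ℕ), ∀ y ∈ Icc (-(T n)) 0, |d2 n y| ≤ K' ∧ ∀ z ∈ Icc (-(T n)) 0,
        |f2 n z - f2 n y| ≤ K' * |z - y| ∧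
        |f2 n z - f2 n y - d2 n y * (z - y)| ≤ K' * (z - y) ^ 2 ∧
        |d2 n z - d2 n y - (h2 (f1 n y) - l2 n) * f2 n y * (z - y)| ≤ K' * (z - y) ^ 2 := by
    filter_upwards [H, bl1, bl2, hT.eventually_ge_atTop 2] with n a b c d
    exact tay2 k _ _ _ _ _ _ _ c b d a.swap
  have hmem : ∀ y ≤ (0:ℝ), ∀ᶠ n in (U : Filter ℕ), y ∈ Ioc (-(T n)) 0 := by
    intro y hy
    filter_upwards [hT.eventually_gt_atTop (-y)] with n hn
    exact ⟨by linarith, hy⟩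
  have cI : ∀ {n y}, y ∈ Ioc (-(T n)) 0 → y ∈ Icc (-(T n)) 0 := fun h => ⟨h.1.le, h.2⟩
  have exF1 : ∀ y, ∃ l, y ≤ 0 → l ∈ Icc 0 C ∧ Tendsto (fun n => f1 n y) U (nhds l) := by
    intro y
    by_cases hy : y ≤ 0
    · obtain ⟨l, hl⟩ := ultra_lim U (u := fun n => f1 n y) (a := 0) (b := C) (by
        filter_upwards [H, hmem y hy] with n a b using a.b1 y (cI b))
      exact ⟨l, fun _ => hl⟩
    · exact ⟨0, fun h => absurd h hy⟩
  have exF2 : ∀ y, ∃ l, y ≤ 0 → l ∈ Icc 0 C ∧ Tendsto (fun n => f2 n y) U (nhds l) := by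
    intro y
    by_cases hy : y ≤ 0
    · obtain ⟨l, hl⟩ := ultra_lim U (u := fun n => f2 n y) (a := 0) (b := C) (by
        filter_upwards [H, hmem y hy] with n a b using a.b2 y (cI b))
      exact ⟨l, fun _ => hl⟩
    · exact ⟨0, fun h => absurd h hy⟩
  have exD1 : ∀ y, ∃ l, y ≤ 0 → Tendsto (fun n => d1 n y) U (nhds l) := by
    intro y
    by_cases hy : y ≤ 0
    · obtain ⟨l, hl⟩ := ultra_lim U (u := fun n => d1 n y) (a := -K) (b := K) (by
        filter_upwards [est1, hmem y hy] with n a b using abs_le.1 (a y (cI b)).1)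
      exact ⟨l, fun _ => hl.2⟩
    · exact ⟨0, fun h => absurd h hy⟩
  have exD2 : ∀ y, ∃ l, y ≤ 0 → Tendsto (fun n => d2 n y) U (nhds l) := by
    intro y
    by_cases hy : y ≤ 0
    · obtain ⟨l, hl⟩ := ultra_lim U (u := fun n => d2 n y) (a := -K') (b := K') (by
        filter_upwards [est2, hmem y hy] with n a b using abs_le.1 (a y (cI b)).1)
      exact ⟨l, fun _ => hl.2⟩
    · exact ⟨0, fun h => absurd h hy⟩
  choose F1 hF1 using exF1
  choose F2 hF2 using exF2
  choose D1 hD1 using exD1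
  choose D2 hD2 using exD2
  have th1 : ∀ y ≤ 0, Tendsto (fun n => h1 (f2 n y)) U (nhds (h1 (F2 y))) := fun y hy =>
    (H1.cd.continuous.tendsto _).comp (hF2 y hy).2
  have th2 : ∀ y ≤ 0, Tendsto (fun n => h2 (f1 n y)) U (nhds (h2 (F1 y))) := fun y hy =>
    (H2.cd.continuous.tendsto _).comp (hF1 y hy).2
  have lip1 : ∀ y ≤ 0, |F1 y - F1 0| ≤ K * |y - 0| := by
    intro y hy
    refine le_of_tendsto ((hF1 y hy).2.sub (hF1 0 le_rfl).2).abs ?_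
    filter_upwards [est1, hmem y hy, hmem 0 le_rfl] with n a b c
    exact ((a 0 (cI c)).2 y (cI b)).1
  have lip2 : ∀ y ≤ 0, |F2 y - F2 0| ≤ K' * |y - 0| := by
    intro y hy
    refine le_of_tendsto ((hF2 y hy).2.sub (hF2 0 le_rfl).2).abs ?_
    filter_upwards [est2, hmem y hy, hmem 0 le_rfl] with n a b c
    exact ((a 0 (cI c)).2 y (cI b)).1
  have cont : ∀ (F : ℝ → ℝ) (K : ℝ), (∀ y ≤ 0, |F y - F 0| ≤ K * |y - 0|) →
      Tendsto F (nhdsWithin 0 (Iio 0)) (nhds (F 0)) := by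
    intro F K h
    rw [tendsto_iff_dist_tendsto_zero]
    refine squeeze_zero' (g := fun y => K * |y - 0|) (Eventually.of_forall fun y => dist_nonneg) ?_ ?_
    · filter_upwards [self_mem_nhdsWithin] with y hy
      rw [Real.dist_eq]; exact h y (le_of_lt hy)
    · have : Tendsto (fun y : ℝ => K * |y - 0|) (nhds 0) (nhds (K * |0 - 0|)) :=
        (Continuous.tendsto (by fun_prop) 0)
      simp only [sub_self, abs_zero, mul_zero] at this
      exact this.mono_left nhdsWithin_le_nhds
  obtain ⟨r1, hr1, sg1⟩ := ultra_sign U k d1 D1 T hT (by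
    filter_upwards [H] with n a
    exact fun y hy => (a.d1d y hy).continuousAt.continuousWithinAt) (H.mono fun n a => a.cr1) hD1
  obtain ⟨r2, hr2, sg2⟩ := ultra_sign U k d2 D2 T hT (by
    filter_upwards [H] with n a
    exact fun y hy => (a.d2d y hy).continuousAt.continuousWithinAt) (H.mono fun n a => a.cr2) hD2
  have hl : HL h1 h2 F1 D1 F2 D2 Λ1 Λ2 C (max r1 r2) :=
    { r0 := hr1.trans (le_max_left _ _)
      C0 := hC
      f1 := by
        refine hasDerivAt_of_taylor (K := K) (fun y hy z hz => ?_)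
        refine le_of_tendsto (((hF1 z hz).2.sub (hF1 y hy).2).sub ((hD1 y hy).mul_const _)).abs ?_
        filter_upwards [est1, hmem y hy, hmem z hz] with n a b c
        exact ((a y (cI b)).2 z (cI c)).2.1
      f2 := by
        refine hasDerivAt_of_taylor (K := K') (fun y hy z hz => ?_)
        refine le_of_tendsto (((hF2 z hz).2.sub (hF2 y hy).2).sub ((hD2 y hy).mul_const _)).abs ?_
        filter_upwards [est2, hmem y hy, hmem z hz] with n a b c
        exact ((a y (cI b)).2 z (cI c)).2.1
      d1 := by
        refine hasDerivAt_of_taylor (D := fun y => (h1 (F2 y) - Λ1) * F1 y) (K := K)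
          (fun y hy z hz => ?_)
        refine le_of_tendsto (((hD1 z hz).sub (hD1 y hy)).sub
          ((((th1 y hy).sub tl1).mul (hF1 y hy).2).mul_const _)).abs ?_
        filter_upwards [est1, hmem y hy, hmem z hz] with n a b c
        exact ((a y (cI b)).2 z (cI c)).2.2
      d2 := by
        refine hasDerivAt_of_taylor (D := fun y => (h2 (F1 y) - Λ2) * F2 y) (K := K')
          (fun y hy z hz => ?_)
        refine le_of_tendsto (((hD2 z hz).sub (hD2 y hy)).sub
          ((((th2 y hy).sub tl2).mul (hF2 y hy).2).mul_const _)).abs ?_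
        filter_upwards [est2, hmem y hy, hmem z hz] with n a b c
        exact ((a y (cI b)).2 z (cI c)).2.2
      b1 := fun y hy => (hF1 y hy.le).1
      b2 := fun y hy => (hF2 y hy.le).1
      c1 := cont F1 K lip1
      c2 := cont F2 K' lip2
      pp := by
        intro y hy a b c d
        obtain ⟨n, q1, q2, q3, q4, q5, q6⟩ := (((tl1.eventually_lt (th1 y hy.le) a)).and
          ((tl2.eventually_lt (th2 y hy.le) b).and
          (((hD1 y hy.le).eventually (lt_mem_nhds c)).and
          (((hD2 y hy.le).eventually (lt_mem_nhds d)).and (H.and (hmem y hy.le)))))).exists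
        exact q5.pp y ⟨q6.1, hy⟩ q1 q2 q3 q4
      mm := by
        intro y hy a b c d
        obtain ⟨n, q1, q2, q3, q4, q5, q6⟩ := ((((th1 y hy.le).eventually_lt tl1 a)).and
          (((th2 y hy.le).eventually_lt tl2 b).and
          (((hD1 y hy.le).eventually (gt_mem_nhds c)).and
          (((hD2 y hy.le).eventually (gt_mem_nhds d)).and (H.and (hmem y hy.le)))))).exists
        exact q5.mm y ⟨q6.1, hy⟩ q1 q2 q3 q4
      s1 := sg1 _ (le_max_left _ _)
      s2 := sg2 _ (le_max_right _ _) }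
  exact ⟨F1 0, F2 0, (hF1 0 le_rfl).2, (hF2 0 le_rfl).2, hl.concl H1 H2 hL1 hL2⟩


lemma first_zero {m : ℝ → ℝ} {a b : ℝ} (hm : Continuous m) (hab : a ≤ b) (ha : 0 ≤ m a)
    (hb : m b ≤ 0) : ∃ c ∈ Icc a b, m c = 0 ∧ ∀ x ∈ Icc a c, 0 ≤ m x := by
  have hne : (Icc a b ∩ m ⁻¹' {0}).Nonempty := by
    obtain ⟨c, hc, h⟩ := intermediate_value_Icc' hab hm.continuousOn ⟨hb, ha⟩
    exact ⟨c, hc, h⟩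
  have hcl : IsClosed (Icc a b ∩ m ⁻¹' {0}) := isClosed_Icc.inter (isClosed_singleton.preimage hm)
  have hbd : BddBelow (Icc a b ∩ m ⁻¹' {0}) := ⟨a, fun x hx => hx.1.1⟩
  have hmem := hcl.csInf_mem hne hbd
  refine ⟨_, hmem.1, hmem.2, fun x hx => ?_⟩
  by_contra hneg
  push Not at hneg
  obtain ⟨c, hc, h⟩ := intermediate_value_Icc' hx.1 hm.continuousOn ⟨hneg.le, ha⟩
  have h1 := csInf_le hbd (show c ∈ Icc a b ∩ m ⁻¹' {0} from
    ⟨⟨hc.1, hc.2.trans (hx.2.trans hmem.1.2)⟩, h⟩)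
  have : x = c := le_antisymm (hx.2.trans h1) hc.2
  subst this
  rw [h] at hneg
  exact lt_irrefl _ hneg

structure Sol (k : ℕ) (ν : ℝ) (h1 h2 v1 d1 v2 d2 : ℝ → ℝ) (l1 l2 : ℝ) : Prop where
  hν : 0 < ν
  v1d : ∀ x, HasDerivAt v1 (d1 x) x
  v2d : ∀ x, HasDerivAt v2 (d2 x) x
  d1d : ∀ x ∈ Icc (0:ℝ) 1, HasDerivAt d1 ((h1 (v2 x) - l1) * v1 x / ν) x
  d2d : ∀ x ∈ Icc (0:ℝ) 1, HasDerivAt d2 ((h2 (v1 x) - l2) * v2 x / ν) x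
  d1c : Continuous d1
  d2c : Continuous d2
  pos1 : ∀ x ∈ Icc (0:ℝ) 1, 0 < v1 x
  pos2 : ∀ x ∈ Icc (0:ℝ) 1, 0 < v2 x
  d10 : d1 0 = 0
  d11 : d1 1 = 0
  d20 : d2 0 = 0
  d21 : d2 1 = 0
  mass1 : ∫ x in (0:ℝ)..1, v1 x ^ 2 = 1
  mass2 : ∫ x in (0:ℝ)..1, v2 x ^ 2 = 1
  cr1 : {x ∈ Ioo (0:ℝ) 1 | d1 x = 0}.Finite ∧ {x ∈ Ioo (0:ℝ) 1 | d1 x = 0}.ncard ≤ k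
  cr2 : {x ∈ Ioo (0:ℝ) 1 | d2 x = 0}.Finite ∧ {x ∈ Ioo (0:ℝ) 1 | d2 x = 0}.ncard ≤ k

namespace Sol
variable {k : ℕ} {ν : ℝ} {h1 h2 v1 d1 v2 d2 : ℝ → ℝ} {l1 l2 : ℝ} {Cg : ℝ}

lemma swap (H : Sol k ν h1 h2 v1 d1 v2 d2 l1 l2) : Sol k ν h2 h1 v2 d2 v1 d1 l2 l1 where
  hν := H.hν
  v1d := H.v2d
  v2d := H.v1d
  d1d := H.d2d
  d2d := H.d1d
  d1c := H.d2c
  d2c := H.d1c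
  pos1 := H.pos2
  pos2 := H.pos1
  d10 := H.d20
  d11 := H.d21
  d20 := H.d10
  d21 := H.d11
  mass1 := H.mass2
  mass2 := H.mass1
  cr1 := H.cr2
  cr2 := H.cr1

lemma v1c (H : Sol k ν h1 h2 v1 d1 v2 d2 l1 l2) : Continuous v1 :=
  continuous_iff_continuousAt.2 fun x => (H.v1d x).continuousAt

lemma v2c (H : Sol k ν h1 h2 v1 d1 v2 d2 l1 l2) : Continuous v2 := H.swap.v1c

lemma crit_refl {d : ℝ → ℝ} (h : {x ∈ Ioo (0:ℝ) 1 | d x = 0}.Finite ∧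
    {x ∈ Ioo (0:ℝ) 1 | d x = 0}.ncard ≤ k) :
    {x ∈ Ioo (0:ℝ) 1 | -d (1 - x) = 0}.Finite ∧
    {x ∈ Ioo (0:ℝ) 1 | -d (1 - x) = 0}.ncard ≤ k := by
  have e : {x ∈ Ioo (0:ℝ) 1 | -d (1 - x) = 0} = (fun x => 1 - x) '' {x ∈ Ioo (0:ℝ) 1 | d x = 0} := by
    ext x
    simp only [mem_image, mem_ofPred_eq, mem_Ioo]
    constructor
    · rintro ⟨⟨a, b⟩, c⟩
      exact ⟨1 - x, ⟨⟨by linarith, by linarith⟩, by linarith⟩, by ring⟩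
    · rintro ⟨y, ⟨⟨a, b⟩, c⟩, rfl⟩
      exact ⟨⟨by linarith, by linarith⟩, by simp [c]⟩
  rw [e]
  exact ⟨h.1.image _, (ncard_image_le h.1).trans h.2⟩

lemma reflect (H : Sol k ν h1 h2 v1 d1 v2 d2 l1 l2) :
    Sol k ν h1 h2 (fun x => v1 (1 - x)) (fun x => - d1 (1 - x)) (fun x => v2 (1 - x))
      (fun x => - d2 (1 - x)) l1 l2 where
  hν := H.hν
  v1d := fun x => ((H.v1d (1 - x)).comp x ((hasDerivAt_id x).const_sub 1)).congr_deriv (by simp)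
  v2d := fun x => ((H.v2d (1 - x)).comp x ((hasDerivAt_id x).const_sub 1)).congr_deriv (by simp)
  d1d := fun x hx => (((H.d1d (1 - x) ⟨by linarith [hx.2], by linarith [hx.1]⟩).comp x
    ((hasDerivAt_id x).const_sub 1)).neg).congr_deriv (by simp)
  d2d := fun x hx => (((H.d2d (1 - x) ⟨by linarith [hx.2], by linarith [hx.1]⟩).comp x
    ((hasDerivAt_id x).const_sub 1)).neg).congr_deriv (by simp)
  d1c := (H.d1c.comp (continuous_const.sub continuous_id)).neg
  d2c := (H.d2c.comp (continuous_const.sub continuous_id)).neg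
  pos1 := fun x hx => H.pos1 _ ⟨by linarith [hx.2], by linarith [hx.1]⟩
  pos2 := fun x hx => H.pos2 _ ⟨by linarith [hx.2], by linarith [hx.1]⟩
  d10 := by simp [H.d11]
  d11 := by simp [H.d10]
  d20 := by simp [H.d21]
  d21 := by simp [H.d20]
  mass1 := by
    rw [intervalIntegral.integral_comp_sub_left (fun x => v1 x ^ 2)]; simpa using H.mass1
  mass2 := by
    rw [intervalIntegral.integral_comp_sub_left (fun x => v2 x ^ 2)]; simpa using H.mass2
  cr1 := crit_refl H.cr1
  cr2 := crit_refl H.cr2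

lemma l_nonneg (H : Sol k ν h1 h2 v1 d1 v2 d2 l1 l2) (hCg : 0 < Cg) (A : HAss Cg h1) : 0 ≤ l1 := by
  by_contra hneg
  push Not at hneg
  have hp : ∀ x ∈ Icc (0:ℝ) 1, 0 < (h1 (v2 x) - l1) * v1 x / ν := by
    intro x hx
    have := A.lb (v2 x)
    have : 0 ≤ Cg⁻¹ * v2 x ^ 2 := by positivity
    exact div_pos (mul_pos (by linarith) (H.pos1 x hx)) H.hν
  obtain ⟨c, hc, h⟩ := exists_hasDerivAt_eq_slope d1 (fun x => (h1 (v2 x) - l1) * v1 x / ν)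
    zero_lt_one H.d1c.continuousOn (fun x hx => H.d1d x ⟨hx.1.le, hx.2.le⟩)
  rw [H.d10, H.d11] at h
  have := hp c ⟨hc.1.le, hc.2.le⟩
  simp only [sub_self, zero_div] at h
  linarith

lemma l_le (H : Sol k ν h1 h2 v1 d1 v2 d2 l1 l2) (A : HAss Cg h1) : l1 ≤ Cg := by
  have hw : ∀ x ∈ Icc (0:ℝ) 1, HasDerivAt (fun x => d1 x / v1 x)
      ((h1 (v2 x) - l1) / ν - (d1 x / v1 x) ^ 2) x := by
    intro x hx
    have hp := H.pos1 x hx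
    have hν := H.hν
    refine ((H.d1d x hx).div (H.v1d x) hp.ne').congr_deriv ?_
    field_simp
  have hv2 := H.v2c
  have hprim : ∀ x, HasDerivAt (fun x => ∫ t in (0:ℝ)..x, v2 t ^ 2) (v2 x ^ 2) x := by
    intro x
    have hc : Continuous fun t => v2 t ^ 2 := hv2.pow 2
    exact intervalIntegral.integral_hasDerivAt_right (hc.intervalIntegrable _ _)
      (hc.stronglyMeasurableAtFilter _ _) hc.continuousAt
  have hν := H.hν
  have key := mvt_ub (a := 0) (b := 1) (m := 0) zero_le_one
    (f := fun x => ν * (d1 x / v1 x) - (Cg * (∫ t in (0:ℝ)..x, v2 t ^ 2) - l1 * x))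
    (fun x hx => ((hw x hx).const_mul ν).sub (((hprim x).const_mul Cg).sub
      ((hasDerivAt_id x).const_mul l1))) ?_
  · simp only [H.d10, H.d11, H.mass2] at key
    simp at key
    linarith
  · intro x hx
    have := A.ub (v2 x)
    have e : ν * ((h1 (v2 x) - l1) / ν - (d1 x / v1 x) ^ 2) = h1 (v2 x) - l1 - ν * (d1 x / v1 x) ^ 2 := by
      field_simp
    rw [e]
    have : 0 ≤ ν * (d1 x / v1 x) ^ 2 := by positivity
    linarith

lemma pp (H : Sol k ν h1 h2 v1 d1 v2 d2 l1 l2) (A1 : HAss Cg h1) (A2 : HAss Cg h2)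
    {x0 : ℝ} (hx0 : x0 ∈ Icc (0:ℝ) 1) (a1 : l1 < h1 (v2 x0)) (a2 : l2 < h2 (v1 x0))
    (p1 : 0 < d1 x0) (p2 : 0 < d2 x0) : False := by
  obtain ⟨c, hc, hz, hm⟩ := first_zero (m := fun x => min (d1 x) (d2 x)) (H.d1c.min H.d2c) hx0.2
    (le_min p1.le p2.le) (by simp [H.d11])
  have hν := H.hν
  have m1 : ∀ x ∈ Icc x0 c, v1 x0 ≤ v1 x := fun x hx => by
    have := mvt_lb (f := v1) (f' := d1) (m := 0) hx.1 (fun z _ => H.v1d z)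
      (fun z hz => (hm z ⟨hz.1, hz.2.trans hx.2⟩).trans (min_le_left _ _))
    linarith
  have m2 : ∀ x ∈ Icc x0 c, v2 x0 ≤ v2 x := fun x hx => by
    have := mvt_lb (f := v2) (f' := d2) (m := 0) hx.1 (fun z _ => H.v2d z)
      (fun z hz => (hm z ⟨hz.1, hz.2.trans hx.2⟩).trans (min_le_right _ _))
    linarith
  have hin : ∀ x ∈ Icc x0 c, x ∈ Icc (0:ℝ) 1 := fun x hx => ⟨hx0.1.trans hx.1, hx.2.trans hc.2⟩
  have k1 := mvt_lb (f := d1) (m := 0) hc.1 (fun x hx => H.d1d x (hin x hx)) (fun x hx => by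
    have := A1.mono.monotoneOn (H.pos2 x0 hx0).le (H.pos2 x (hin x hx)).le (m2 x hx)
    exact div_nonneg (mul_nonneg (by linarith) (H.pos1 x (hin x hx)).le) hν.le)
  have k2 := mvt_lb (f := d2) (m := 0) hc.1 (fun x hx => H.d2d x (hin x hx)) (fun x hx => by
    have := A2.mono.monotoneOn (H.pos1 x0 hx0).le (H.pos1 x (hin x hx)).le (m1 x hx)
    exact div_nonneg (mul_nonneg (by linarith) (H.pos2 x (hin x hx)).le) hν.le)
  have : 0 < min (d1 c) (d2 c) := lt_min (by linarith) (by linarith)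
  linarith

lemma mm (H : Sol k ν h1 h2 v1 d1 v2 d2 l1 l2) (A1 : HAss Cg h1) (A2 : HAss Cg h2)
    {x0 : ℝ} (hx0 : x0 ∈ Icc (0:ℝ) 1) (a1 : h1 (v2 x0) < l1) (a2 : h2 (v1 x0) < l2)
    (p1 : d1 x0 < 0) (p2 : d2 x0 < 0) : False := by
  obtain ⟨c, hc, hz, hm⟩ := first_zero (m := fun x => min (-d1 x) (-d2 x)) (H.d1c.neg.min H.d2c.neg)
    hx0.2 (le_min (by linarith) (by linarith)) (by simp [H.d11])
  have hν := H.hν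
  have m1 : ∀ x ∈ Icc x0 c, v1 x ≤ v1 x0 := fun x hx => by
    have := mvt_ub (f := v1) (f' := d1) (m := 0) hx.1 (fun z _ => H.v1d z)
      (fun z hz => by linarith [(hm z ⟨hz.1, hz.2.trans hx.2⟩).trans (min_le_left _ _)])
    linarith
  have m2 : ∀ x ∈ Icc x0 c, v2 x ≤ v2 x0 := fun x hx => by
    have := mvt_ub (f := v2) (f' := d2) (m := 0) hx.1 (fun z _ => H.v2d z)
      (fun z hz => by linarith [(hm z ⟨hz.1, hz.2.trans hx.2⟩).trans (min_le_right _ _)])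
    linarith
  have hin : ∀ x ∈ Icc x0 c, x ∈ Icc (0:ℝ) 1 := fun x hx => ⟨hx0.1.trans hx.1, hx.2.trans hc.2⟩
  have k1 := mvt_ub (f := d1) (m := 0) hc.1 (fun x hx => H.d1d x (hin x hx)) (fun x hx => by
    have := A1.mono.monotoneOn (H.pos2 x (hin x hx)).le (H.pos2 x0 hx0).le (m2 x hx)
    exact div_nonpos_of_nonpos_of_nonneg
      (mul_nonpos_of_nonpos_of_nonneg (by linarith) (H.pos1 x (hin x hx)).le) hν.le)
  have k2 := mvt_ub (f := d2) (m := 0) hc.1 (fun x hx => H.d2d x (hin x hx)) (fun x hx => by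
    have := A2.mono.monotoneOn (H.pos1 x (hin x hx)).le (H.pos1 x0 hx0).le (m1 x hx)
    exact div_nonpos_of_nonpos_of_nonneg
      (mul_nonpos_of_nonpos_of_nonneg (by linarith) (H.pos2 x (hin x hx)).le) hν.le)
  have : 0 < min (-d1 c) (-d2 c) := lt_min (by linarith) (by linarith)
  linarith

end Sol

lemma mass_sub {v : ℝ → ℝ} (hv : Continuous v) (hm : ∫ x in (0:ℝ)..1, v x ^ 2 = 1) {a b V : ℝ}
    (ha : 0 ≤ a) (hab : a ≤ b) (hb : b ≤ 1) (hV : ∀ x ∈ Icc a b, V ≤ v x ^ 2) :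
    V * (b - a) ≤ 1 := by
  have hc : Continuous fun t => v t ^ 2 := hv.pow 2
  have e1 : ∫ x in a..b, V ≤ ∫ x in a..b, v x ^ 2 :=
    intervalIntegral.integral_mono_on hab (by simp) (hc.intervalIntegrable _ _) hV
  have e2 : ∫ x in a..b, v x ^ 2 ≤ ∫ x in (0:ℝ)..1, v x ^ 2 :=
    intervalIntegral.integral_mono_interval ha hab hb
      (Filter.Eventually.of_forall fun x => by positivity) (hc.intervalIntegrable _ _)
  rw [hm] at e2
  simp at e1
  linarith

lemma mono_mass {v d : ℝ → ℝ} (hv : ∀ x, HasDerivAt v (d x) x) (hd : Continuous d)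
    (hpos : ∀ x ∈ Icc (0:ℝ) 1, 0 < v x)
    (hm : ∫ x in (0:ℝ)..1, v x ^ 2 = 1) {α β t : ℝ} (h0 : 0 ≤ α) (h1 : β ≤ 1) (ht : 0 < t)
    (hne : ∀ x ∈ Ioo α β, d x ≠ 0) : ∀ x ∈ Icc (α + t) (β - t), v x ^ 2 * t ≤ 1 := by
  intro x hx
  have hx' : x ∈ Ioo α β := ⟨by linarith [hx.1], by linarith [hx.2]⟩
  have hvc : Continuous v := continuous_iff_continuousAt.2 fun x => (hv x).continuousAt
  have hpx := hpos x ⟨by linarith [hx'.1], by linarith [hx'.2]⟩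
  rcases lt_or_gt_of_ne (hne x hx') with hs | hs
  · have hneg : ∀ y ∈ Ioo α β, d y ≤ 0 := by
      intro y hy
      by_contra hcon
      push Not at hcon
      obtain ⟨z, hz, hz0⟩ := isPreconnected_Ioo.intermediate_value hx' hy hd.continuousOn
        ⟨hs.le, hcon.le⟩
      exact hne z hz hz0
    have h := mass_sub hvc hm (a := x - t) (b := x) (V := v x ^ 2) (by linarith [hx.1]) (by linarith)
      (by linarith [hx'.2]) ?_
    · have e : x - (x - t) = t := by ring
      rwa [e] at h
    · intro y hy
      -- antitone
      have : AntitoneOn v (Icc α β) := by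
        apply antitoneOn_of_deriv_nonpos (convex_Icc _ _) hvc.continuousOn
        · exact fun z _ => (hv z).differentiableAt.differentiableWithinAt
        · intro z hz
          rw [(hv z).deriv]
          rw [interior_Icc] at hz
          exact hneg z hz
      have h2 := this (show y ∈ Icc α β from ⟨by linarith [hy.1, hx.1], by linarith [hy.2, hx'.2]⟩)
        ⟨hx'.1.le, hx'.2.le⟩ hy.2
      gcongr
  · have hneg : ∀ y ∈ Ioo α β, 0 ≤ d y := by
      intro y hy
      by_contra hcon
      push Not at hcon
      obtain ⟨z, hz, hz0⟩ := isPreconnected_Ioo.intermediate_value hy hx' hd.continuousOn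
        ⟨hcon.le, hs.le⟩
      exact hne z hz hz0
    have h := mass_sub hvc hm (a := x) (b := x + t) (V := v x ^ 2) (by linarith [hx'.1]) (by linarith)
      (by linarith [hx.2]) ?_
    · have e : x + t - x = t := by ring
      rwa [e] at h
    · intro y hy
      have : MonotoneOn v (Icc α β) := by
        apply monotoneOn_of_deriv_nonneg (convex_Icc _ _) hvc.continuousOn
        · exact fun z _ => (hv z).differentiableAt.differentiableWithinAt
        · intro z hz
          rw [(hv z).deriv]
          rw [interior_Icc] at hz
          exact hneg z hz
      have h2 := this ⟨hx'.1.le, hx'.2.le⟩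
        (show y ∈ Icc α β from ⟨by linarith [hy.1, hx'.1], by linarith [hy.2, hx.2]⟩) hy.1
      gcongr

lemma pigeon {A : Set ℝ} (hA : A.Finite) {m : ℕ} (hm : A.ncard ≤ m) :
    ∃ j : ℕ, j ≤ m ∧ ∀ x ∈ Ioo ((j:ℝ) / (m + 1)) ((j + 1 : ℝ) / (m + 1)), x ∉ A := by
  by_contra hcon
  push Not at hcon
  choose! f hf1 hf2 using hcon
  have hm1 : (0:ℝ) < m + 1 := by positivity
  have hinj : Set.InjOn f (Finset.range (m + 1) : Set ℕ) := by
    intro i hi j hj hij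
    simp only [Finset.coe_range, mem_Iio] at hi hj
    have a := hf1 i (by omega)
    have b := hf1 j (by omega)
    rw [mem_Ioo, div_lt_iff₀ hm1, lt_div_iff₀ hm1] at a b
    rw [hij] at a
    have p : (i:ℝ) < j + 1 := by linarith [a.1, b.2]
    have q : (j:ℝ) < i + 1 := by linarith [b.1, a.2]
    have p' : i < j + 1 := by exact_mod_cast p
    have q' : j < i + 1 := by exact_mod_cast q
    omega
  have h1 : (f '' (Finset.range (m + 1) : Set ℕ)).ncard ≤ A.ncard := by
    apply ncard_le_ncard _ hA
    rintro _ ⟨i, hi, rfl⟩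
    simp only [Finset.coe_range, mem_Iio] at hi
    exact hf2 i (by omega)
  rw [hinj.ncard_image, ncard_coe_finset, Finset.card_range] at h1
  omega

lemma Sol.gap {k : ℕ} {ν : ℝ} {h1 h2 v1 d1 v2 d2 : ℝ → ℝ} {l1 l2 : ℝ}
    (H : Sol k ν h1 h2 v1 d1 v2 d2 l1 l2) :
    ∃ p : ℝ, 0 ≤ p ∧ p + 1 / (6 * k + 3) ≤ 1 ∧ ∀ x ∈ Icc p (p + 1 / (6 * k + 3)),
      v1 x ≤ 6 * k + 3 ∧ v2 x ≤ 6 * k + 3 := by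
  obtain ⟨j, hj, hA⟩ := pigeon (H.cr1.1.union H.cr2.1) (m := 2 * k)
    ((ncard_union_le _ _).trans (by have := H.cr1.2; have := H.cr2.2; omega))
  have hK : (0:ℝ) < 6 * k + 3 := by positivity
  have hj' : (j:ℝ) ≤ 2 * k := by exact_mod_cast hj
  push_cast at hA
  have hK' : (0:ℝ) < 2 * k + 1 := by positivity
  have hα : 0 ≤ (j:ℝ) / (2 * k + 1) := by positivity
  have hβ : ((j:ℝ) + 1) / (2 * k + 1) ≤ 1 := by rw [div_le_one hK']; linarith
  have ht : (0:ℝ) < 1 / (6 * k + 3) := by positivity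
  have e : ((j:ℝ) + 1) / (2 * k + 1) = (j:ℝ) / (2 * k + 1) + 3 * (1 / (6 * k + 3)) := by
    field_simp; ring
  have hn1 : ∀ x ∈ Ioo ((j:ℝ) / (2 * k + 1)) (((j:ℝ) + 1) / (2 * k + 1)), d1 x ≠ 0 :=
    fun x hx h => hA x hx (Or.inl ⟨⟨by linarith [hx.1], by linarith [hx.2]⟩, h⟩)
  have hn2 : ∀ x ∈ Ioo ((j:ℝ) / (2 * k + 1)) (((j:ℝ) + 1) / (2 * k + 1)), d2 x ≠ 0 :=
    fun x hx h => hA x hx (Or.inr ⟨⟨by linarith [hx.1], by linarith [hx.2]⟩, h⟩)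
  have b1 := mono_mass H.v1d H.d1c H.pos1 H.mass1 hα hβ ht hn1
  have b2 := mono_mass H.v2d H.d2c H.pos2 H.mass2 hα hβ ht hn2
  have fin : ∀ v : ℝ, v ^ 2 * (1 / (6 * k + 3)) ≤ 1 → v ≤ 6 * k + 3 := by
    intro v hv
    rw [mul_one_div, div_le_one hK] at hv
    have : (0:ℝ) ≤ k := by positivity
    nlinarith
  refine ⟨(j:ℝ) / (2 * k + 1) + 1 / (6 * k + 3), by positivity, by linarith, fun x hx => ?_⟩
  have hx' : x ∈ Icc ((j:ℝ) / (2 * k + 1) + 1 / (6 * k + 3))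
    (((j:ℝ) + 1) / (2 * k + 1) - 1 / (6 * k + 3)) := ⟨hx.1, by linarith [hx.2]⟩
  exact ⟨fin _ (b1 x hx'), fin _ (b2 x hx')⟩


lemma convex_big {f e E : ℝ → ℝ} {a q c R : ℝ} (hq : 0 < q) (hc : 0 ≤ c)
    (hf : ∀ x ∈ Icc a (a + 4 * q), HasDerivAt f (e x) x)
    (he : ∀ x ∈ Icc a (a + 4 * q), HasDerivAt e (E x) x)
    (hE : ∀ x ∈ Icc a (a + 4 * q), c ≤ E x) (hb : ∀ x ∈ Icc a (a + 4 * q), f x ∈ Icc 0 R) :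
    c * q ^ 2 ≤ R := by
  have hgrow : ∀ x ∈ Icc a (a + 4 * q), ∀ y ∈ Icc a (a + 4 * q), x ≤ y → c * (y - x) ≤ e y - e x := by
    intro x hx y hy hxy
    exact mvt_lb hxy (fun z hz => he z ⟨hx.1.trans hz.1, hz.2.trans hy.2⟩)
      (fun z hz => hE z ⟨hx.1.trans hz.1, hz.2.trans hy.2⟩)
  have hmid : a + 2 * q ∈ Icc a (a + 4 * q) := ⟨by linarith, by linarith⟩
  rcases le_total 0 (e (a + 2 * q)) with h | h
  · have := mvt_lb (f := f) (f' := e) (a := a + 3 * q) (b := a + 4 * q) (m := c * q) (by linarith)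
      (fun z hz => hf z ⟨by linarith [hz.1], hz.2⟩) (fun z hz => by
        have h1 := hgrow _ hmid z ⟨by linarith [hz.1], hz.2⟩ (by linarith [hz.1])
        have h2 : c * q ≤ c * (z - (a + 2 * q)) := by
          apply mul_le_mul_of_nonneg_left _ hc; linarith [hz.1]
        linarith)
    have b1 := (hb (a + 4 * q) ⟨by linarith, le_refl _⟩).2
    have b2 := (hb (a + 3 * q) ⟨by linarith, by linarith⟩).1
    nlinarith
  · have := mvt_ub (f := f) (f' := e) (a := a) (b := a + q) (m := -(c * q)) (by linarith)
      (fun z hz => hf z ⟨hz.1, by linarith [hz.2]⟩) (fun z hz => by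
        have h1 := hgrow z ⟨hz.1, by linarith [hz.2]⟩ _ hmid (by linarith [hz.2])
        have h2 : c * q ≤ c * ((a + 2 * q) - z) := by
          apply mul_le_mul_of_nonneg_left _ hc; linarith [hz.2]
        linarith)
    have b1 := (hb (a + q) ⟨by linarith, by linarith⟩).1
    have b2 := (hb a ⟨by linarith, by linarith⟩).2
    nlinarith

lemma caseB0 {h1 h2 f1 e1 f2 e2 : ℝ → ℝ} {Cg l1 l2 L M ε R t0 η P S Q c : ℝ} (hCg : 0 < Cg)
    (A1 : HAss Cg h1) (A2 : HAss Cg h2) (hε : 0 < ε)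
    (hf1 : ∀ y ∈ Icc 0 L, HasDerivAt f1 (e1 y) y) (hf2 : ∀ y ∈ Icc 0 L, HasDerivAt f2 (e2 y) y)
    (he1 : ∀ y ∈ Icc 0 L, HasDerivAt e1 ((h1 (f2 y) - l1) * f1 y) y)
    (he2 : ∀ y ∈ Icc 0 L, HasDerivAt e2 ((h2 (f1 y) - l2) * f2 y) y)
    (p1 : ∀ y ∈ Icc 0 L, 0 < f1 y) (p2 : ∀ y ∈ Icc 0 L, 0 < f2 y)
    (b1 : ∀ y ∈ Icc 0 L, f1 y ≤ M) (b2 : ∀ y ∈ Icc 0 L, f2 y ≤ R)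
    (hM : f1 0 = M) (e10 : e1 0 = 0) (hl1 : ε ≤ l1) (hl1' : l1 ≤ Cg) (hl2 : 0 ≤ l2)
    (ht0 : 0 < t0) (hCt : Cg * t0 ^ 2 ≤ 1 / 2) (hη : 0 < η) (hCη : Cg * η ^ 2 ≤ ε / 2)
    (hP : P = Real.pi / √(ε / 2)) (hS : S * P = η / 2) (hS0 : 0 < S) (hQ : S * Q = 4 * R) (hQ0 : 0 < Q)
    (hl2Q : l2 * R * Q ≤ S / 2) (hL : t0 + P + Q ≤ L)
    (hc0 : 0 ≤ c) (hc : c ≤ (Cg⁻¹ * (M / 2) ^ 2 - l2) * (η / 2)) (hcR : R < c * (t0 / 8) ^ 2)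
    (hcl : l2 ≤ Cg⁻¹ * (M / 2) ^ 2) : False := by
  have hP0 : 0 < P := by
    rw [hP]; exact div_pos Real.pi_pos (Real.sqrt_pos.2 (by linarith))
  have hM0 : 0 < M := by rw [← hM]; exact p1 0 ⟨le_refl _, by linarith⟩
  have hR0 : 0 < R := by nlinarith
  have hl10 : 0 ≤ l1 := by linarith
  have hnn : ∀ h, HAss Cg h → ∀ x, 0 ≤ h x := fun h A x => by
    have := A.lb x
    have : 0 ≤ Cg⁻¹ * x ^ 2 := by positivity
    linarith
  -- f1 large on [0,t0]
  have s1 : ∀ y ∈ Icc 0 t0, -(Cg * M) * t0 ≤ e1 y := by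
    intro y hy
    have := mvt_lb (f := e1) (a := 0) (b := y) (m := -(Cg * M)) hy.1
      (fun z hz => he1 z ⟨hz.1, by linarith [hz.2, hy.2]⟩) (fun z hz => by
        have hz' : z ∈ Icc 0 L := ⟨hz.1, by linarith [hz.2, hy.2]⟩
        have a := hnn h1 A1 (f2 z)
        have b := p1 z hz'
        have c := b1 z hz'
        have d : l1 * f1 z ≤ Cg * M := mul_le_mul hl1' c b.le hCg.le
        nlinarith [mul_nonneg a b.le])
    have h3 : (Cg * M) * y ≤ Cg * M * t0 := mul_le_mul_of_nonneg_left hy.2 (by positivity)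
    rw [e10] at this
    linarith
  have s2 : ∀ y ∈ Icc 0 t0, M / 2 ≤ f1 y := by
    intro y hy
    have := mvt_lb (f := f1) (f' := e1) (a := 0) (b := y) (m := -(Cg * M) * t0) hy.1
      (fun z hz => hf1 z ⟨hz.1, by linarith [hz.2, hy.2]⟩) (fun z hz => s1 z ⟨hz.1, hz.2.trans hy.2⟩)
    have h3 : (Cg * M * t0) * y ≤ (Cg * M * t0) * t0 := mul_le_mul_of_nonneg_left hy.2 (by positivity)
    have h4 : (Cg * t0 ^ 2) * M ≤ 1 / 2 * M := mul_le_mul_of_nonneg_right hCt hM0.le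
    rw [hM] at this
    nlinarith
  -- small point of f2
  obtain ⟨t, ht, hft⟩ : ∃ t ∈ Icc (t0 / 2) (t0 / 2 + 4 * (t0 / 8)), f2 t ≤ η / 2 := by
    by_contra hcon
    push Not at hcon
    have hsub : ∀ x ∈ Icc (t0 / 2) (t0 / 2 + 4 * (t0 / 8)), x ∈ Icc 0 L := fun x hx =>
      ⟨by linarith [hx.1], by linarith [hx.2]⟩
    have := convex_big (f := f2) (e := e2) (a := t0 / 2) (q := t0 / 8) (c := c) (R := R) (by linarith) hc0
      (fun x hx => hf2 x (hsub x hx)) (fun x hx => he2 x (hsub x hx)) (fun x hx => by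
        have a := A2.lb (f1 x)
        have b := s2 x ⟨by linarith [hx.1], by linarith [hx.2]⟩
        have d : Cg⁻¹ * (M / 2) ^ 2 ≤ Cg⁻¹ * f1 x ^ 2 := by gcongr
        refine hc.trans ?_
        exact mul_le_mul (by linarith) (hcon x hx).le (by linarith) (by linarith))
      (fun x hx => ⟨(p2 x (hsub x hx)).le, b2 x (hsub x hx)⟩)
    linarith
  have ht1 : t ≤ t0 := by linarith [ht.2]
  have ht2 : 0 ≤ t := by linarith [ht.1]
  -- slope bound
  have s3 : ∀ s ∈ Icc t (t + P), e2 s ≤ S := by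
    intro s hs
    by_contra hcon
    push Not at hcon
    have hsub : ∀ x ∈ Icc s (s + Q), x ∈ Icc 0 L := fun x hx =>
      ⟨by linarith [hx.1, hs.1], by linarith [hx.2, hs.2]⟩
    have g1 : ∀ y ∈ Icc s (s + Q), S / 2 ≤ e2 y := by
      intro y hy
      have := mvt_lb (f := e2) (a := s) (b := y) (m := -(l2 * R)) hy.1
        (fun z hz => he2 z (hsub z ⟨hz.1, hz.2.trans hy.2⟩)) (fun z hz => by
          have hz' := hsub z ⟨hz.1, hz.2.trans hy.2⟩
          have a := hnn h2 A2 (f1 z)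
          have b := p2 z hz'
          have d : l2 * f2 z ≤ l2 * R := mul_le_mul_of_nonneg_left (b2 z hz') hl2
          nlinarith [mul_nonneg a b.le])
      have h3 : (l2 * R) * (y - s) ≤ l2 * R * Q :=
        mul_le_mul_of_nonneg_left (by linarith [hy.2]) (by positivity)
      linarith
    have := mvt_lb (f := f2) (f' := e2) (a := s) (b := s + Q) (m := S / 2) (by linarith)
      (fun z hz => hf2 z (hsub z hz)) g1
    have a := b2 (s + Q) (hsub _ ⟨by linarith, le_refl _⟩)
    have b := p2 s (hsub _ ⟨le_refl _, by linarith⟩)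
    nlinarith
  have hsub : ∀ x ∈ Icc t (t + P), x ∈ Icc 0 L := fun x hx =>
      ⟨by linarith [hx.1], by linarith [hx.2]⟩
  have s4 : ∀ s ∈ Icc t (t + P), f2 s ≤ η := by
    intro s hs
    have := mvt_ub (f := f2) (f' := e2) (a := t) (b := s) (m := S) hs.1
      (fun z hz => hf2 z (hsub z ⟨hz.1, hz.2.trans hs.2⟩)) (fun z hz => s3 z ⟨hz.1, hz.2.trans hs.2⟩)
    have h3 : S * (s - t) ≤ S * P := mul_le_mul_of_nonneg_left (by linarith [hs.2]) hS0.le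
    linarith
  refine sturm (κ := ε / 2) (a := t) (b := t + P) (by linarith) (by rw [hP])
    (fun x hx => hf1 x (hsub x hx)) (fun x hx => he1 x (hsub x hx)) (fun x hx => ?_)
    (fun x hx => p1 x (hsub x hx))
  have a := A1.ub (f2 x)
  have b : Cg * f2 x ^ 2 ≤ Cg * η ^ 2 := by
    have := p2 x (hsub x hx)
    have := s4 x hx
    gcongr
  exact mul_le_mul_of_nonneg_right (by linarith) (p1 x (hsub x hx)).le

lemma Sol.rescale_at {k : ℕ} {ν : ℝ} {h1 h2 v1 d1 v2 d2 : ℝ → ℝ} {l1 l2 : ℝ}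
    (H : Sol k ν h1 h2 v1 d1 v2 d2 l1 l2) (x y : ℝ) :
    HasDerivAt (fun y => v1 (x + √ν * y)) (√ν * d1 (x + √ν * y)) y ∧
    (x + √ν * y ∈ Icc (0:ℝ) 1 → HasDerivAt (fun y => √ν * d1 (x + √ν * y))
      ((h1 (v2 (x + √ν * y)) - l1) * v1 (x + √ν * y)) y) := by
  have hs : HasDerivAt (fun y : ℝ => x + √ν * y) (√ν) y :=
    (((hasDerivAt_id y).const_mul (√ν)).const_add x).congr_deriv (by simp)
  have hν := H.hν
  have hss : √ν * √ν = ν := Real.mul_self_sqrt hν.le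
  constructor
  · exact ((H.v1d (x + √ν * y)).comp y hs).congr_deriv (by ring)
  · intro hm
    refine (((H.d1d _ hm).comp y hs).const_mul (√ν)).congr_deriv ?_
    rw [div_mul_eq_mul_div, mul_div_assoc', div_eq_iff hν.ne', ← hss]
    simp only [hss]
    linear_combination ((h1 (v2 (x + √ν * y)) - l1) * v1 (x + √ν * y)) * hss

lemma caseB {h1 h2 : ℝ → ℝ} {Cg ε R : ℝ} (hCg : 0 < Cg)
    (A1 : HAss Cg h1) (A2 : HAss Cg h2) (hε : 0 < ε) (hR : 0 < R) :
    ∃ δ > 0, ∀ (k : ℕ) (ν : ℝ) (v1 d1 v2 d2 : ℝ → ℝ) (l1 l2 : ℝ),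
      Sol k ν h1 h2 v1 d1 v2 d2 l1 l2 → ε ≤ l1 → (∀ x ∈ Icc (0:ℝ) 1, v2 x ≤ R) → l2 ≤ δ →
      ν ≤ δ → (∃ B ∈ Icc (0:ℝ) 1, 1 / δ ≤ v1 B) → False := by
  obtain ⟨t0, ht0, hCt⟩ : ∃ t0 > 0, Cg * t0 ^ 2 ≤ 1 / 2 := by
    refine ⟨1 / (Cg + 1), by positivity, ?_⟩
    rw [div_pow, one_pow, mul_one_div, div_le_div_iff₀ (by positivity) (by norm_num)]
    nlinarith [sq_nonneg (Cg - 1)]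
  obtain ⟨η, hη, hCη⟩ : ∃ η > 0, Cg * η ^ 2 ≤ ε / 2 := by
    refine ⟨√(ε / (2 * Cg)), Real.sqrt_pos.2 (by positivity), ?_⟩
    rw [Real.sq_sqrt (by positivity)]
    apply le_of_eq; field_simp
  obtain ⟨P, hP⟩ : ∃ P, P = Real.pi / √(ε / 2) := ⟨_, rfl⟩
  have hP0 : 0 < P := by
    rw [hP]; exact div_pos Real.pi_pos (Real.sqrt_pos.2 (by linarith))
  obtain ⟨S, hS0, hS⟩ : ∃ S > 0, S * P = η / 2 :=
    ⟨η / 2 / P, by positivity, by field_simp⟩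
  obtain ⟨Q, hQ0, hQ⟩ : ∃ Q > 0, S * Q = 4 * R := ⟨4 * R / S, by positivity, by field_simp⟩
  obtain ⟨c, hc0, hcR⟩ : ∃ c > 0, R < c * (t0 / 8) ^ 2 := by
    refine ⟨2 * R / (t0 / 8) ^ 2, by positivity, ?_⟩
    rw [div_mul_cancel₀ _ (by positivity)]; linarith
  obtain ⟨M0, hM0⟩ : ∃ M0, M0 = max 1 (4 * Cg * (1 + c * 2 / η)) := ⟨_, rfl⟩
  have hM1 : 1 ≤ M0 := by rw [hM0]; exact le_max_left _ _
  have hM2 : 4 * Cg * (1 + c * 2 / η) ≤ M0 := by rw [hM0]; exact le_max_right _ _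
  set Z := t0 + P + Q with hZ
  have hZ0 : 0 < Z := by positivity
  obtain ⟨δ, hδ0, q1, q2, q3, q4⟩ : ∃ δ > 0, δ ≤ 1 ∧ δ ≤ 1 / M0 ∧ δ ≤ S / (2 * R * Q) ∧
      δ ≤ (1 / (2 * Z)) ^ 2 := by
    refine ⟨min (min 1 (1 / M0)) (min (S / (2 * R * Q)) ((1 / (2 * Z)) ^ 2)), ?_, ?_, ?_, ?_, ?_⟩
    · apply lt_min <;> apply lt_min <;> positivity
    · exact (min_le_left _ _).trans (min_le_left _ _)
    · exact (min_le_left _ _).trans (min_le_right _ _)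
    · exact (min_le_right _ _).trans (min_le_left _ _)
    · exact (min_le_right _ _).trans (min_le_right _ _)
  refine ⟨δ, hδ0, ?_⟩
  -- claim with maximum in the left half
  have main : ∀ (k : ℕ) (ν : ℝ) (v1 d1 v2 d2 : ℝ → ℝ) (l1 l2 : ℝ),
      Sol k ν h1 h2 v1 d1 v2 d2 l1 l2 → ε ≤ l1 → (∀ x ∈ Icc (0:ℝ) 1, v2 x ≤ R) → l2 ≤ δ →
      ν ≤ δ → ∀ B ∈ Icc (0:ℝ) (1/2), 1 / δ ≤ v1 B → (∀ x ∈ Icc (0:ℝ) 1, v1 x ≤ v1 B) → False := by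
    intro k ν v1 d1 v2 d2 l1 l2 H hl1 hv2 hl2 hνδ B hB hBδ hBm
    have hν := H.hν
    have hsν : 0 < √ν := Real.sqrt_pos.2 hν
    have hl2' := H.swap.l_nonneg hCg A2
    have hMM : M0 ≤ v1 B := by
      refine le_trans ?_ hBδ
      rw [le_div_iff₀ hδ0]
      rw [le_div_iff₀ (by linarith)] at q2
      linarith
    have hsZ : √ν ≤ 1 / (2 * Z) := by
      apply Real.sqrt_le_iff.2
      exact ⟨by positivity, hνδ.trans q4⟩
    have hdB : d1 B = 0 := by
      rcases eq_or_lt_of_le hB.1 with h | h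
      · rw [← h]; exact H.d10
      · apply IsLocalMax.hasDerivAt_eq_zero (f := v1) (a := B) _ (H.v1d B)
        filter_upwards [Ioo_mem_nhds h (show B < 1 by linarith [hB.2])] with x hx
        exact hBm x ⟨hx.1.le, hx.2.le⟩
    have hin : ∀ y ∈ Icc 0 Z, B + √ν * y ∈ Icc (0:ℝ) 1 := by
      intro y hy
      have a : √ν * y ≤ 1 / (2 * Z) * Z := mul_le_mul hsZ hy.2 hy.1 (by positivity)
      have b : 1 / (2 * Z) * Z = 1 / 2 := by field_simp
      exact ⟨add_nonneg hB.1 (mul_nonneg hsν.le hy.1), by linarith [hB.2]⟩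
    have hcl : 1 + c * 2 / η ≤ Cg⁻¹ * (v1 B / 2) ^ 2 := by
      have h1 : 4 * Cg * (1 + c * 2 / η) ≤ v1 B ^ 2 := by nlinarith
      calc 1 + c * 2 / η = Cg⁻¹ * (4 * Cg * (1 + c * 2 / η)) / 4 := by field_simp
        _ ≤ Cg⁻¹ * (v1 B ^ 2) / 4 := by gcongr
        _ = _ := by ring
    have hcη : 0 < c * 2 / η := by positivity
    refine caseB0 (f1 := fun y => v1 (B + √ν * y)) (e1 := fun y => √ν * d1 (B + √ν * y))
      (f2 := fun y => v2 (B + √ν * y)) (e2 := fun y => √ν * d2 (B + √ν * y)) (M := v1 B) (L := Z)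
      (l1 := l1) (l2 := l2) (R := R) (c := c)
      hCg A1 A2 hε (fun y hy => (H.rescale_at B y).1) (fun y hy => (H.swap.rescale_at B y).1)
      (fun y hy => (H.rescale_at B y).2 (hin y hy)) (fun y hy => (H.swap.rescale_at B y).2 (hin y hy))
      (fun y hy => H.pos1 _ (hin y hy)) (fun y hy => H.pos2 _ (hin y hy))
      (fun y hy => hBm _ (hin y hy)) (fun y hy => hv2 _ (hin y hy)) (by simp) (by simp [hdB])
      hl1 (H.l_le A1) hl2' ht0 hCt hη hCη hP hS hS0 hQ hQ0 ?_ le_rfl hc0.le ?_ hcR ?_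
    · have h2 := hl2.trans q3
      rw [le_div_iff₀ (by positivity)] at h2
      linarith
    · have h2 : c * 2 / η ≤ Cg⁻¹ * (v1 B / 2) ^ 2 - l2 := by linarith
      calc c = c * 2 / η * (η / 2) := by field_simp
        _ ≤ _ := by gcongr
    · linarith
  intro k ν v1 d1 v2 d2 l1 l2 H hl1 hv2 hl2 hνδ ⟨B0, hB0, hBδ⟩
  obtain ⟨B, hB, hmax⟩ := isCompact_Icc.exists_isMaxOn (nonempty_Icc.2 (zero_le_one' ℝ)) H.v1c.continuousOn
  rw [isMaxOn_iff] at hmax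
  have hBδ' : 1 / δ ≤ v1 B := hBδ.trans (hmax B0 hB0)
  rcases le_total B (1/2) with h | h
  · exact main k ν v1 d1 v2 d2 l1 l2 H hl1 hv2 hl2 hνδ B ⟨hB.1, h⟩ hBδ' hmax
  · have hrefl : ∀ x ∈ Icc (0:ℝ) 1, 1 - x ∈ Icc (0:ℝ) 1 := fun x hx =>
      ⟨by linarith [hx.2], by linarith [hx.1]⟩
    exact main k ν _ _ _ _ l1 l2 H.reflect hl1 (fun x hx => hv2 _ (hrefl x hx)) hl2 hνδ (1 - B)
      ⟨by linarith [hB.2], by linarith⟩ (by simpa using hBδ')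
      (fun x hx => by simpa using hmax _ (hrefl x hx))


lemma crit_rescale {d : ℝ → ℝ} {k : ℕ} {s T y : ℝ} (hs : 0 < s) (h0 : 0 ≤ y - s * T) (h1 : y ≤ 1)
    (h : {x ∈ Ioo (0:ℝ) 1 | d x = 0}.Finite ∧ {x ∈ Ioo (0:ℝ) 1 | d x = 0}.ncard ≤ k) :
    {t ∈ Ioo (-T) 0 | s * d (y + s * t) = 0}.Finite ∧
    {t ∈ Ioo (-T) 0 | s * d (y + s * t) = 0}.ncard ≤ k := by
  have hmaps : ∀ t ∈ {t ∈ Ioo (-T) 0 | s * d (y + s * t) = 0},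
      y + s * t ∈ {x ∈ Ioo (0:ℝ) 1 | d x = 0} := by
    rintro t ⟨⟨a, b⟩, c⟩
    refine ⟨⟨?_, ?_⟩, (mul_eq_zero.1 c).resolve_left hs.ne'⟩
    · have := mul_lt_mul_of_pos_left a hs
      linarith
    · have := mul_neg_of_pos_of_neg hs b
      linarith
  have hinj : Set.InjOn (fun t => y + s * t) {t ∈ Ioo (-T) 0 | s * d (y + s * t) = 0} := by
    intro a _ b _ hab
    simpa [hs.ne'] using hab
  exact ⟨Set.Finite.of_injOn hmaps hinj h.1,
    (Set.ncard_le_ncard_of_injOn _ hmaps hinj h.1).trans h.2⟩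

/-- a long interval on which both components are bounded, ending where the bound is attained -/
def Good (c C : ℝ) (v1 v2 : ℝ → ℝ) (y : ℝ) : Prop :=
  0 ≤ y - c ∧ y ≤ 1 ∧ (∀ x ∈ Icc (y - c) y, v1 x ≤ C ∧ v2 x ≤ C) ∧ max (v1 y) (v2 y) = C

lemma good_right {k : ℕ} {ν : ℝ} {h1 h2 v1 d1 v2 d2 : ℝ → ℝ} {l1 l2 : ℝ}
    (H : Sol k ν h1 h2 v1 d1 v2 d2 l1 l2) {C p c B : ℝ} (hp : 0 ≤ p) (hc : 0 < c)
    (hb : ∀ x ∈ Icc p (p + c), v1 x ≤ C ∧ v2 x ≤ C) (hB : p + c ≤ B) (hB1 : B ≤ 1)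
    (hBC : C < v1 B ∨ C < v2 B) : ∃ y, Good c C v1 v2 y := by
  have hpc := hb (p + c) ⟨by linarith, le_refl _⟩
  obtain ⟨y, hy, hz, hm⟩ := first_zero (m := fun x => C - max (v1 x) (v2 x))
    (continuous_const.sub (H.v1c.max H.v2c)) hB (sub_nonneg.2 (max_le hpc.1 hpc.2))
    (sub_nonpos.2 (by
      rcases hBC with h | h
      · exact h.le.trans (le_max_left _ _)
      · exact h.le.trans (le_max_right _ _)))
  refine ⟨y, by linarith [hy.1], by linarith [hy.2], fun x hx => ?_, by linarith⟩
  rcases le_total x (p + c) with h | h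
  · exact hb x ⟨by linarith [hx.1, hy.1], h⟩
  · have := hm x ⟨h, hx.2⟩
    exact max_le_iff.1 (by linarith)

lemma good_or {k : ℕ} {ν : ℝ} {h1 h2 v1 d1 v2 d2 : ℝ → ℝ} {l1 l2 : ℝ}
    (H : Sol k ν h1 h2 v1 d1 v2 d2 l1 l2) {C : ℝ} (hC : 6 * k + 3 ≤ C)
    (hB : ∃ B ∈ Icc (0:ℝ) 1, C < v1 B ∨ C < v2 B) :
    (∃ y, Good (1 / (6 * k + 3)) C v1 v2 y) ∨
    (∃ y, Good (1 / (6 * k + 3)) C (fun x => v1 (1 - x)) (fun x => v2 (1 - x)) y) := by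
  obtain ⟨B, hB, hBC⟩ := hB
  obtain ⟨p, hp, hp1, hb⟩ := H.gap
  have hc : (0:ℝ) < 1 / (6 * k + 3) := by positivity
  have hb' : ∀ x ∈ Icc p (p + 1 / (6 * k + 3)), v1 x ≤ C ∧ v2 x ≤ C := fun x hx =>
    ⟨(hb x hx).1.trans hC, (hb x hx).2.trans hC⟩
  rcases le_total (p + 1 / (6 * k + 3)) B with h | h
  · exact Or.inl (good_right H hp hc hb' h hB.2 hBC)
  · right
    have hBp : B < p := by
      by_contra hcon
      push Not at hcon
      have := hb' B ⟨hcon, h⟩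
      rcases hBC with h | h <;> linarith
    refine good_right H.reflect (p := 1 - p - 1 / (6 * k + 3)) (B := 1 - B) (by linarith) hc
      (fun x hx => hb' _ ⟨by linarith [hx.2], by linarith [hx.1]⟩) (by linarith) (by linarith [hB.1])
      (by simpa using hBC)

lemma Sol.toRs {k : ℕ} {ν : ℝ} {h1 h2 v1 d1 v2 d2 : ℝ → ℝ} {l1 l2 Cg : ℝ}
    (H : Sol k ν h1 h2 v1 d1 v2 d2 l1 l2) (A1 : HAss Cg h1) (A2 : HAss Cg h2)
    {c C y : ℝ} (G : Good c C v1 v2 y) :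
    Rs k h1 h2 (fun t => v1 (y + √ν * t)) (fun t => √ν * d1 (y + √ν * t))
      (fun t => v2 (y + √ν * t)) (fun t => √ν * d2 (y + √ν * t)) l1 l2 C (c / √ν) := by
  obtain ⟨g0, g1, gb, -⟩ := G
  have hν := H.hν
  have hs : 0 < √ν := Real.sqrt_pos.2 hν
  have hT : √ν * (c / √ν) = c := by field_simp
  have hin : ∀ t ∈ Icc (-(c / √ν)) 0, y + √ν * t ∈ Icc (y - c) y := by
    intro t ht
    have a := mul_le_mul_of_nonneg_left ht.1 hs.le
    have b := mul_nonpos_of_nonneg_of_nonpos hs.le ht.2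
    exact ⟨by linarith, by linarith⟩
  have hin' : ∀ t ∈ Icc (-(c / √ν)) 0, y + √ν * t ∈ Icc (0:ℝ) 1 := fun t ht =>
    ⟨g0.trans (hin t ht).1, (hin t ht).2.trans g1⟩
  exact {
    f1d := fun t => (H.rescale_at y t).1
    f2d := fun t => (H.swap.rescale_at y t).1
    d1d := fun t ht => (H.rescale_at y t).2 (hin' t ht)
    d2d := fun t ht => (H.swap.rescale_at y t).2 (hin' t ht)
    b1 := fun t ht => ⟨(H.pos1 _ (hin' t ht)).le, (gb _ (hin t ht)).1⟩
    b2 := fun t ht => ⟨(H.pos2 _ (hin' t ht)).le, (gb _ (hin t ht)).2⟩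
    cr1 := crit_rescale hs (by rw [hT]; exact g0) g1 H.cr1
    cr2 := crit_rescale hs (by rw [hT]; exact g0) g1 H.cr2
    pp := fun t ht a b c d => H.pp A1 A2 (hin' t ⟨ht.1.le, ht.2.le⟩) a b
      ((mul_pos_iff_of_pos_left hs).1 c) ((mul_pos_iff_of_pos_left hs).1 d)
    mm := fun t ht a b c d => H.mm A1 A2 (hin' t ⟨ht.1.le, ht.2.le⟩) a b
      (neg_of_mul_neg_right c hs.le) (neg_of_mul_neg_right d hs.le) }

lemma caseA_right {U : Ultrafilter ℕ} {k : ℕ} {h1 h2 : ℝ → ℝ} {Cg C c Λ1 Λ2 : ℝ} (hCg : 0 < Cg)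
    (A1 : HAss Cg h1) (A2 : HAss Cg h2) (hC : Cg < C) (hc : 0 < c)
    {ν l1 l2 : ℕ → ℝ} {v1 d1 v2 d2 : ℕ → ℝ → ℝ}
    (H : ∀ n, Sol k (ν n) h1 h2 (v1 n) (d1 n) (v2 n) (d2 n) (l1 n) (l2 n))
    (hL1 : 0 < Λ1) (hL2 : 0 < Λ2) (tl1 : Tendsto l1 U (nhds Λ1)) (tl2 : Tendsto l2 U (nhds Λ2))
    (hν : Tendsto ν U (nhds 0)) (G : ∀ᶠ n in U, ∃ y, Good c C (v1 n) (v2 n) y) : False := by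
  obtain ⟨y, hy⟩ := Filter.skolem.1 G
  have hT : Tendsto (fun n => c / √(ν n)) U atTop := by
    have h1 : Tendsto (fun n => √(ν n)) U (nhdsWithin 0 (Ioi 0)) := by
      rw [tendsto_nhdsWithin_iff]
      refine ⟨?_, Eventually.of_forall fun n => Real.sqrt_pos.2 (H n).hν⟩
      simpa [Function.comp_def] using (Real.continuous_sqrt.tendsto 0).comp hν
    simpa [div_eq_mul_inv] using (tendsto_inv_nhdsGT_zero.comp h1).const_mul_atTop hc
  obtain ⟨V1, V2, t1, t2, hV⟩ := core_limit (C := C) (k := k) U hCg A1 A2 (by linarith) hL1 hL2 tl1 tl2 hT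
    (f1 := fun n t => v1 n (y n + √(ν n) * t)) (d1 := fun n t => √(ν n) * d1 n (y n + √(ν n) * t))
    (f2 := fun n t => v2 n (y n + √(ν n) * t)) (d2 := fun n t => √(ν n) * d2 n (y n + √(ν n) * t))
    (by filter_upwards [hy] with n hn using (H n).toRs A1 A2 hn)
  have hmax : max V1 V2 = C := by
    refine tendsto_nhds_unique (t1.max t2) (tendsto_const_nhds.congr' ?_)
    filter_upwards [hy] with n hn
    simpa using hn.2.2.2.symm
  have e1 : Λ1 ≤ Cg := le_of_tendsto tl1 (Eventually.of_forall fun n => (H n).l_le A1)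
  have e2 : Λ2 ≤ Cg := le_of_tendsto tl2 (Eventually.of_forall fun n => (H n).swap.l_le A2)
  have key : ∀ h, HAss Cg h → ∀ V, h V ≤ Cg → V ≤ Cg := by
    intro h A V hV
    have := (A.lb V).trans hV
    rw [inv_mul_le_iff₀ hCg] at this
    nlinarith
  rcases hV with ⟨a, b⟩ | ⟨a, b⟩
  · rw [a, b] at hmax
    simp at hmax
    linarith
  · have := max_le (key h2 A2 V1 (by linarith)) (key h1 A1 V2 (by linarith))
    linarith

lemma caseA {U : Ultrafilter ℕ} {k : ℕ} {h1 h2 : ℝ → ℝ} {Cg Λ1 Λ2 : ℝ} (hCg : 0 < Cg)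
    (A1 : HAss Cg h1) (A2 : HAss Cg h2)
    {ν l1 l2 : ℕ → ℝ} {v1 d1 v2 d2 : ℕ → ℝ → ℝ}
    (H : ∀ n, Sol k (ν n) h1 h2 (v1 n) (d1 n) (v2 n) (d2 n) (l1 n) (l2 n))
    (hL1 : 0 < Λ1) (hL2 : 0 < Λ2) (tl1 : Tendsto l1 U (nhds Λ1)) (tl2 : Tendsto l2 U (nhds Λ2))
    (hν : Tendsto ν U (nhds 0))
    (hB : ∀ C, ∀ᶠ n in U, ∃ B ∈ Icc (0:ℝ) 1, C < v1 n B) : False := by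
  have hc : (0:ℝ) < 1 / (6 * k + 3) := by positivity
  have hk : (0:ℝ) ≤ k := by positivity
  have G : ∀ᶠ n in U, (∃ y, Good (1 / (6 * k + 3)) (6 * k + 3 + Cg) (v1 n) (v2 n) y) ∨
    (∃ y, Good (1 / (6 * k + 3)) (6 * k + 3 + Cg) (fun x => v1 n (1 - x)) (fun x => v2 n (1 - x)) y) := by
    filter_upwards [hB (6 * k + 3 + Cg)] with n hn
    obtain ⟨B, hB, h⟩ := hn
    exact good_or (H n) (by linarith) ⟨B, hB, Or.inl h⟩
  rcases Ultrafilter.eventually_or.1 G with G | G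
  · exact caseA_right hCg A1 A2 (by linarith) hc H hL1 hL2 tl1 tl2 hν G
  · exact caseA_right hCg A1 A2 (by linarith) hc (fun n => (H n).reflect) hL1 hL2 tl1 tl2 hν G

lemma caseAB {U : Ultrafilter ℕ} {k : ℕ} {h1 h2 : ℝ → ℝ} {Cg ε1 ε2 R1 R2 : ℝ} (hCg : 0 < Cg)
    (A1 : HAss Cg h1) (A2 : HAss Cg h2)
    {ν l1 l2 : ℕ → ℝ} {v1 d1 v2 d2 : ℕ → ℝ → ℝ}
    (H : ∀ n, Sol k (ν n) h1 h2 (v1 n) (d1 n) (v2 n) (d2 n) (l1 n) (l2 n))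
    (hε1 : 0 < ε1) (hε2 : 0 < ε2)
    (hν : Tendsto ν U (nhds 0))
    (o1 : ∀ᶠ n in U, ε1 ≤ l1 n ∨ ∀ x ∈ Icc (0:ℝ) 1, v1 n x ≤ R1)
    (o2 : ∀ᶠ n in U, ε2 ≤ l2 n ∨ ∀ x ∈ Icc (0:ℝ) 1, v2 n x ≤ R2)
    (hB : ∀ C, ∀ᶠ n in U, ∃ B ∈ Icc (0:ℝ) 1, C < v1 n B) : False := by
  have g1 : ∀ᶠ n in U, ε1 ≤ l1 n := by
    filter_upwards [o1, hB R1] with n a b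
    obtain ⟨B, hB, hb⟩ := b
    rcases a with a | a
    · exact a
    · linarith [a B hB]
  obtain ⟨Λ1, hL1, tl1⟩ := ultra_lim U (u := l1) (a := 0) (b := Cg)
    (Eventually.of_forall fun n => ⟨(H n).l_nonneg hCg A1, (H n).l_le A1⟩)
  obtain ⟨Λ2, hL2, tl2⟩ := ultra_lim U (u := l2) (a := 0) (b := Cg)
    (Eventually.of_forall fun n => ⟨(H n).swap.l_nonneg hCg A2, (H n).swap.l_le A2⟩)
  have hL1' : 0 < Λ1 := lt_of_lt_of_le hε1 (ge_of_tendsto tl1 g1)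
  rcases eq_or_lt_of_le hL2.1 with h | h
  · rw [← h] at tl2
    obtain ⟨δ, hδ, hfal⟩ := caseB hCg A1 A2 hε1 (show 0 < max R2 1 by positivity)
    have := (((((tl2.eventually (gt_mem_nhds hε2)).and (tl2.eventually (gt_mem_nhds hδ))).and
      (hν.eventually (gt_mem_nhds hδ))).and (g1.and o2)).and (hB (1 / δ))).exists
    obtain ⟨n, ⟨⟨⟨a, b⟩, c⟩, d, e⟩, B, hB, f⟩ := this
    refine hfal k _ _ _ _ _ _ _ (H n) d (fun x hx => ?_) b.le c.le ⟨B, hB, f.le⟩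
    rcases e with e | e
    · linarith
    · exact (e x hx).trans (le_max_left _ _)
  · exact caseA hCg A1 A2 H hL1' h tl1 tl2 hν hB

lemma GAss.toHAss' {Cg : ℝ} {g : ℝ → ℝ} (g1 : ContDiffOn ℝ 2 g (Set.Ici 0))
    (g2 : StrictMonoOn g (Set.Ici 0)) (g3 : ∀ s : ℝ, 0 ≤ s → Cg⁻¹ * s ≤ g s ∧ g s ≤ Cg * s) :
    HAss Cg (fun x => g (x ^ 2)) where
  cd := by
    have : ContDiff ℝ 2 (fun x : ℝ => g (x ^ 2)) :=
      g1.comp_contDiff (contDiff_id.pow 2) (fun x => sq_nonneg x)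
    exact this.of_le (by norm_num)
  mono := by
    intro a ha b hb hab
    have ha' : (0:ℝ) ≤ a := ha
    exact g2 (sq_nonneg a) (sq_nonneg b) (by nlinarith)
  lb := fun x => (g3 _ (sq_nonneg x)).1
  ub := fun x => (g3 _ (sq_nonneg x)).2

lemma sup_lt_iff' {f : ℝ → ℝ} {C : ℝ}
    (h : C < sSup (f '' Icc (0:ℝ) 1)) : ∃ B ∈ Icc (0:ℝ) 1, C < f B := by
  obtain ⟨_, ⟨B, hB, rfl⟩, h⟩ := exists_lt_of_lt_csSup
    ((nonempty_Icc.2 (zero_le_one' ℝ)).image f) h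
  exact ⟨B, hB, h⟩

lemma sup_ge {f : ℝ → ℝ} (hf : Continuous f) {x : ℝ} (hx : x ∈ Icc (0:ℝ) 1) :
    f x ≤ sSup (f '' Icc (0:ℝ) 1) :=
  le_csSup (isCompact_Icc.image hf).bddAbove ⟨x, hx, rfl⟩

lemma extract {l s : ℕ → ℝ} (hl : ∀ n, 0 ≤ l n)
    (h : ∀ ε > 0, ∀ R : ℝ, ∃ᶠ n in atTop, l n < ε ∧ R < s n) :
    ∃ φ : ℕ → ℕ, StrictMono φ ∧ Tendsto (fun m => l (φ m)) atTop (nhds 0) ∧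
      Tendsto (fun m => s (φ m)) atTop atTop := by
  obtain ⟨φ, hφ, hp⟩ := Filter.extraction_forall_of_frequently
    (P := fun m n => l n < 1 / ((m:ℝ) + 1) ∧ (m:ℝ) < s n) (fun m => h _ (by positivity) _)
  refine ⟨φ, hφ, ?_, ?_⟩
  · exact squeeze_zero (fun m => hl _) (fun m => (hp m).1.le) tendsto_one_div_add_atTop_nhds_zero_nat
  · exact tendsto_atTop_mono (fun m => (hp m).2.le) tendsto_natCast_atTop_atTop

lemma final {k : ℕ} {h1 h2 : ℝ → ℝ} {Cg : ℝ} (hCg : 0 < Cg)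
    (A1 : HAss Cg h1) (A2 : HAss Cg h2)
    {ν l1 l2 : ℕ → ℝ} {v1 d1 v2 d2 : ℕ → ℝ → ℝ}
    (H : ∀ n, Sol k (ν n) h1 h2 (v1 n) (d1 n) (v2 n) (d2 n) (l1 n) (l2 n))
    (hν0 : Tendsto ν atTop (nhds 0))
    (hmax : Tendsto (fun n => sSup ((fun x => v1 n x + v2 n x) '' Set.Icc (0:ℝ) 1)) atTop atTop) :
    ∃ φ : ℕ → ℕ, StrictMono φ ∧
      ((Tendsto (fun m => l1 (φ m)) atTop (nhds 0) ∧
        Tendsto (fun m => sSup ((fun x => |v1 (φ m) x|) '' Set.Icc (0:ℝ) 1)) atTop atTop) ∨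
       (Tendsto (fun m => l2 (φ m)) atTop (nhds 0) ∧
        Tendsto (fun m => sSup ((fun x => |v2 (φ m) x|) '' Set.Icc (0:ℝ) 1)) atTop atTop)) := by
  by_cases c1 : ∀ ε > 0, ∀ R : ℝ, ∃ᶠ n in atTop, l1 n < ε ∧
      R < sSup ((fun x => |v1 n x|) '' Set.Icc (0:ℝ) 1)
  · obtain ⟨φ, a, b, c⟩ := extract (fun n => (H n).l_nonneg hCg A1) c1
    exact ⟨φ, a, Or.inl ⟨b, c⟩⟩
  by_cases c2 : ∀ ε > 0, ∀ R : ℝ, ∃ᶠ n in atTop, l2 n < ε ∧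
      R < sSup ((fun x => |v2 n x|) '' Set.Icc (0:ℝ) 1)
  · obtain ⟨φ, a, b, c⟩ := extract (fun n => (H n).swap.l_nonneg hCg A2) c2
    exact ⟨φ, a, Or.inr ⟨b, c⟩⟩
  exfalso
  push Not at c1 c2
  obtain ⟨ε1, hε1, R1, o1⟩ := c1
  obtain ⟨ε2, hε2, R2, o2⟩ := c2
  have hU : (hyperfilter ℕ : Filter ℕ) ≤ atTop := by
    rw [← Nat.cofinite_eq_atTop]; exact hyperfilter_le_cofinite
  have o1' : ∀ᶠ n in (hyperfilter ℕ : Filter ℕ), ε1 ≤ l1 n ∨ ∀ x ∈ Icc (0:ℝ) 1, v1 n x ≤ R1 := by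
    filter_upwards [hU o1] with n hn
    rcases lt_or_ge (l1 n) ε1 with h | h
    · exact Or.inr fun x hx => (le_abs_self _).trans ((sup_ge (H n).v1c.abs hx).trans (hn h))
    · exact Or.inl h
  have o2' : ∀ᶠ n in (hyperfilter ℕ : Filter ℕ), ε2 ≤ l2 n ∨ ∀ x ∈ Icc (0:ℝ) 1, v2 n x ≤ R2 := by
    filter_upwards [hU o2] with n hn
    rcases lt_or_ge (l2 n) ε2 with h | h
    · exact Or.inr fun x hx => (le_abs_self _).trans ((sup_ge (H n).v2c.abs hx).trans (hn h))
    · exact Or.inl h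
  have hνU : Tendsto ν (hyperfilter ℕ : Filter ℕ) (nhds 0) := hν0.mono_left hU
  have hbig : ∀ C, ∀ᶠ n in (hyperfilter ℕ : Filter ℕ), (∃ B ∈ Icc (0:ℝ) 1, C < v1 n B) ∨
      (∃ B ∈ Icc (0:ℝ) 1, C < v2 n B) := by
    intro C
    filter_upwards [hU (hmax.eventually (eventually_gt_atTop (2 * C)))] with n hn
    obtain ⟨B, hB, h⟩ := sup_lt_iff' hn
    rcases lt_or_ge C (v1 n B) with h' | h'
    · exact Or.inl ⟨B, hB, h'⟩
    · exact Or.inr ⟨B, hB, by linarith⟩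
  by_cases hd : ∀ C, ∀ᶠ n in (hyperfilter ℕ : Filter ℕ), ∃ B ∈ Icc (0:ℝ) 1, C < v1 n B
  · exact caseAB hCg A1 A2 H hε1 hε2 hνU o1' o2' hd
  · push Not at hd
    obtain ⟨C0, hC0⟩ := hd
    refine caseAB hCg A2 A1 (fun n => (H n).swap) hε2 hε1 hνU o2' o1' (fun C => ?_)
    filter_upwards [hC0, hbig (max C C0)] with n a b
    rcases b with ⟨B, hB, h⟩ | ⟨B, hB, h⟩
    · have := a B hB
      linarith [le_max_right C C0]
    · exact ⟨B, hB, (le_max_left _ _).trans_lt h⟩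

lemma IsSolution.toSol {ν : ℝ} {g₁ g₂ v₁ v₂ : ℝ → ℝ} {l₁ l₂ : ℝ} {k : ℕ} (hν : 0 < ν)
    (h : IsSolution ν g₁ g₂ v₁ v₂ l₁ l₂)
    (hk : ({x ∈ Set.Ioo (0:ℝ) 1 | deriv v₁ x = 0}.Finite ∧
        {x ∈ Set.Ioo (0:ℝ) 1 | deriv v₁ x = 0}.ncard ≤ k) ∧
      ({x ∈ Set.Ioo (0:ℝ) 1 | deriv v₂ x = 0}.Finite ∧
        {x ∈ Set.Ioo (0:ℝ) 1 | deriv v₂ x = 0}.ncard ≤ k)) :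
    Sol k ν (fun x => g₁ (x ^ 2)) (fun x => g₂ (x ^ 2)) v₁ (deriv v₁) v₂ (deriv v₂) l₁ l₂ := by
  obtain ⟨c1, c2, e1, e2, p1, p2, b1, b2, b3, b4, m1, m2⟩ := h
  have c1' : ContDiff ℝ 1 (deriv v₁) := by
    have : ContDiff ℝ (1 + 1) v₁ := by norm_num; exact c1
    exact (contDiff_succ_iff_deriv.1 this).2.2
  have c2' : ContDiff ℝ 1 (deriv v₂) := by
    have : ContDiff ℝ (1 + 1) v₂ := by norm_num; exact c2
    exact (contDiff_succ_iff_deriv.1 this).2.2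
  exact {
    hν := hν
    v1d := fun x => (c1.differentiable (by norm_num) x).hasDerivAt
    v2d := fun x => (c2.differentiable (by norm_num) x).hasDerivAt
    d1d := fun x hx => (c1'.differentiable (by norm_num) x).hasDerivAt.congr_deriv (by
      rw [eq_div_iff hν.ne']; linarith [e1 x hx])
    d2d := fun x hx => (c2'.differentiable (by norm_num) x).hasDerivAt.congr_deriv (by
      rw [eq_div_iff hν.ne']; linarith [e2 x hx])
    d1c := c1'.continuous
    d2c := c2'.continuous
    pos1 := p1
    pos2 := p2
    d10 := b1
    d11 := b2
    d20 := b3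
    d21 := b4
    mass1 := m1
    mass2 := m2
    cr1 := hk.1
    cr2 := hk.2 }

theorem stmt_14 (Cg : ℝ) (k : ℕ) (g₁ g₂ : ℝ → ℝ)
    (ν l₁ l₂ : ℕ → ℝ) (v₁ v₂ : ℕ → ℝ → ℝ)
    (hCg : 0 < Cg) (hg₁ : GAss Cg g₁) (hg₂ : GAss Cg g₂)
    (hν : ∀ n, 0 < ν n)
    (hsol : ∀ n, IsSolution (ν n) g₁ g₂ (v₁ n) (v₂ n) (l₁ n) (l₂ n))
    (hnt : ∀ n, ¬ IsTrivialSol (v₁ n) (v₂ n))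
    (hk : ∀ n,
      ({x ∈ Set.Ioo (0:ℝ) 1 | deriv (v₁ n) x = 0}.Finite ∧
        {x ∈ Set.Ioo (0:ℝ) 1 | deriv (v₁ n) x = 0}.ncard ≤ k) ∧
      ({x ∈ Set.Ioo (0:ℝ) 1 | deriv (v₂ n) x = 0}.Finite ∧
        {x ∈ Set.Ioo (0:ℝ) 1 | deriv (v₂ n) x = 0}.ncard ≤ k))
    (hν0 : Tendsto ν atTop (nhds 0))
    (hmax : Tendsto (fun n => sSup ((fun x => v₁ n x + v₂ n x) '' Set.Icc (0:ℝ) 1))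
      atTop atTop) :
    ∃ φ : ℕ → ℕ, StrictMono φ ∧
      ((Tendsto (fun m => l₁ (φ m)) atTop (nhds 0) ∧
        Tendsto (fun m => sSup ((fun x => |v₁ (φ m) x|) '' Set.Icc (0:ℝ) 1))
          atTop atTop) ∨
       (Tendsto (fun m => l₂ (φ m)) atTop (nhds 0) ∧
        Tendsto (fun m => sSup ((fun x => |v₂ (φ m) x|) '' Set.Icc (0:ℝ) 1))
          atTop atTop)) := by
  exact final hCg (GAss.toHAss' hg₁.1 hg₁.2.1 hg₁.2.2) (GAss.toHAss' hg₂.1 hg₂.2.1 hg₂.2.2)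
    (fun n => (hsol n).toSol (hν n) (hk n)) hν0 hmax
end

section
/- Let (v₁,v₂,λ₁,λ₂) be a monotone solution of the one-dimensional system with viscosity ν (v₁ decreasing, v₂ increasing), and let ξ₁, ξ₂ ∈ (0,1) satisfy v₁''(ξ₁) = 0 and v₂''(ξ₂) = 0. Then: (i) v₁(x)² ≤ 1/x for all x ∈ (0,1] and v₂(x)² ≤ 1/(1−x) for all x ∈ [0,1); (ii) ξ₁·[v₁(0)² + v₁(0)v₁(ξ₁) + v₁(ξ₁)²] ≤ 3 and (1−ξ₂)·[v₂(1)² + v₂(1)v₂(ξ₂) + v₂(ξ₂)²] ≤ 3; (iii) |v₁'(x)|·(x−x₀) ≤ x₀^{−1/2} for every x₀ ≥ ξ₁ and x ∈ [x₀,1], and |v₂'(x)|·(x₀−x) ≤ (1−x₀)^{−1/2} for every x₀ ≤ ξ₂ and x ∈ [0,x₀]. -/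
open Set Filter MeasureTheory

theorem core_bounds (v c : ℝ → ℝ) (ξ : ℝ) (hv : ContDiff ℝ 2 v)
    (hode : ∀ x ∈ Set.Icc (0:ℝ) 1, deriv (deriv v) x = c x * v x)
    (hc : MonotoneOn c (Set.Icc 0 1))
    (hpos : ∀ x ∈ Set.Icc (0:ℝ) 1, 0 < v x)
    (hd1 : deriv v 1 = 0) (hint : (∫ x in (0:ℝ)..1, (v x) ^ 2) = 1)
    (hmono : AntitoneOn v (Set.Icc 0 1))
    (hξ : ξ ∈ Set.Ioo (0:ℝ) 1) (hinfl : deriv (deriv v) ξ = 0) :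
    (∀ x ∈ Set.Ioc (0:ℝ) 1, (v x) ^ 2 ≤ 1 / x) ∧
    ξ * ((v 0) ^ 2 + v 0 * v ξ + (v ξ) ^ 2) ≤ 3 ∧
    (∀ x₀ : ℝ, ξ ≤ x₀ → ∀ x ∈ Set.Icc x₀ 1,
      |deriv v x| * (x - x₀) ≤ (Real.sqrt x₀)⁻¹) := by
  obtain ⟨hξ0, hξ1⟩ := hξ
  have hcont : Continuous v := hv.continuous
  have hdiff : Differentiable ℝ v := hv.differentiable (by norm_num)
  have hdv : ContDiff ℝ 1 (deriv v) := by
    have : ContDiff ℝ (1 + 1) v := by simpa [one_add_one_eq_two] using hv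
    exact (contDiff_succ_iff_deriv.1 this).2.2
  have hddiff : Differentiable ℝ (deriv v) := hdv.differentiable (by norm_num)
  have hii : ∀ a b : ℝ, IntervalIntegrable (fun x => (v x) ^ 2) volume a b :=
    fun a b => (hcont.pow 2).intervalIntegrable a b
  have hpart : ∀ x ∈ Set.Icc (0:ℝ) 1, (∫ t in (0:ℝ)..x, (v t) ^ 2) ≤ 1 := by
    intro x hx
    have h := intervalIntegral.integral_add_adjacent_intervals (hii 0 x) (hii x 1)
    have h2 : 0 ≤ ∫ t in x..1, (v t) ^ 2 :=
      intervalIntegral.integral_nonneg hx.2 (fun t _ => sq_nonneg _)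
    linarith
  have hcξ : c ξ = 0 := by
    have h := hode ξ ⟨hξ0.le, hξ1.le⟩
    have hp := hpos ξ ⟨hξ0.le, hξ1.le⟩
    rw [hinfl] at h
    rcases mul_eq_zero.1 h.symm with h | h
    · exact h
    · exact absurd h hp.ne'
  have hi : ∀ x ∈ Set.Ioc (0:ℝ) 1, (v x) ^ 2 ≤ 1 / x := by
    intro x hx
    rw [le_div_iff₀ hx.1]
    have h := intervalIntegral.integral_mono_on (μ := volume) hx.1.le
      (intervalIntegrable_const (c := (v x) ^ 2)) (hii 0 x) (fun t ht => by
        have h1 := hmono ⟨ht.1, ht.2.trans hx.2⟩ ⟨hx.1.le, hx.2⟩ ht.2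
        have h2 := hpos x ⟨hx.1.le, hx.2⟩
        exact pow_le_pow_left₀ h2.le h1 2)
    rw [intervalIntegral.integral_const] at h
    have h3 := hpart x ⟨hx.1.le, hx.2⟩
    simp only [sub_zero, smul_eq_mul] at h
    linarith
  refine ⟨hi, ?_, ?_⟩
  · have hconc : ConcaveOn ℝ (Set.Icc 0 ξ) v := by
      apply concaveOn_of_deriv2_nonpos (convex_Icc 0 ξ) hcont.continuousOn
        hdiff.differentiableOn hddiff.differentiableOn
      intro x hx
      rw [interior_Icc] at hx
      have hx' : x ∈ Set.Icc (0:ℝ) 1 := ⟨hx.1.le, (hx.2.trans hξ1).le⟩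
      have h1 := hc hx' ⟨hξ0.le, hξ1.le⟩ hx.2.le
      change deriv (deriv v) x ≤ 0
      rw [hode x hx']
      exact mul_nonpos_of_nonpos_of_nonneg (h1.trans hcξ.le) (hpos x hx').le
    have hL : ∀ t ∈ Set.Icc 0 ξ, (v 0 + (v ξ - v 0) / ξ * t) ^ 2 ≤ (v t) ^ 2 := by
      intro t ht
      have q1 : 0 ≤ 1 - t / ξ := by rw [sub_nonneg, div_le_one hξ0]; exact ht.2
      have q2 : 0 ≤ t / ξ := div_nonneg ht.1 hξ0.le
      have h := hconc.2 (left_mem_Icc.2 hξ0.le) (right_mem_Icc.2 hξ0.le) q1 q2 (by ring)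
      simp only [smul_eq_mul, mul_zero, zero_add] at h
      rw [div_mul_cancel₀ _ hξ0.ne'] at h
      have e : v 0 + (v ξ - v 0) / ξ * t = (1 - t / ξ) * v 0 + t / ξ * v ξ := by ring
      have h0 : 0 ≤ (1 - t / ξ) * v 0 + t / ξ * v ξ := by
        have a1 : 0 ≤ 1 - t / ξ := by rw [sub_nonneg, div_le_one hξ0]; exact ht.2
        have a2 : 0 ≤ t / ξ := div_nonneg ht.1 hξ0.le
        have a3 := hpos 0 ⟨le_rfl, zero_le_one⟩
        have a4 := hpos ξ ⟨hξ0.le, hξ1.le⟩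
        positivity
      rw [e]
      exact pow_le_pow_left₀ h0 h 2
    have h := intervalIntegral.integral_mono_on (μ := volume) hξ0.le
      (Continuous.intervalIntegrable (by fun_prop) 0 ξ) (hii 0 ξ) hL
    have hval : (∫ t in (0:ℝ)..ξ, (v 0 + (v ξ - v 0) / ξ * t) ^ 2)
        = ξ * ((v 0) ^ 2 + v 0 * v ξ + (v ξ) ^ 2) / 3 := by
      generalize v 0 = a
      generalize v ξ = b
      have hder : ∀ t ∈ Set.uIcc 0 ξ, HasDerivAt
          (fun t : ℝ => a ^ 2 * t + a * ((b - a) / ξ) * t ^ 2 + ((b - a) / ξ) ^ 2 * t ^ 3 / 3)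
          ((a + (b - a) / ξ * t) ^ 2) t := by
        intro t _
        have := (((hasDerivAt_id t).const_mul (a ^ 2)).add
          ((hasDerivAt_pow 2 t).const_mul (a * ((b - a) / ξ)))).add
          (((hasDerivAt_pow 3 t).const_mul (((b - a) / ξ) ^ 2)).div_const 3)
        have e : (a + (b - a) / ξ * t) ^ 2 = a ^ 2 * 1
            + a * ((b - a) / ξ) * (((2 : ℕ) : ℝ) * t ^ (2 - 1))
            + ((b - a) / ξ) ^ 2 * (((3 : ℕ) : ℝ) * t ^ (3 - 1)) / 3 := by
          norm_num
          ring
        rw [e]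
        exact this
      rw [intervalIntegral.integral_eq_sub_of_hasDerivAt hder
        (Continuous.intervalIntegrable (by fun_prop) 0 ξ)]
      field_simp
      ring
    have h3 := hpart ξ ⟨hξ0.le, hξ1.le⟩
    rw [hval] at h
    linarith
  · intro x₀ hx₀ x hx
    have hdm : MonotoneOn (deriv v) (Set.Icc ξ 1) := by
      apply monotoneOn_of_deriv_nonneg (convex_Icc ξ 1) hddiff.continuous.continuousOn
        hddiff.differentiableOn
      intro y hy
      rw [interior_Icc] at hy
      have hy' : y ∈ Set.Icc (0:ℝ) 1 := ⟨(hξ0.trans hy.1).le, hy.2.le⟩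
      have h1 := hc ⟨hξ0.le, hξ1.le⟩ hy' hy.1.le
      rw [hode y hy']
      exact mul_nonneg (hcξ.ge.trans h1) (hpos y hy').le
    have hx01 : x₀ ≤ 1 := hx.1.trans hx.2
    have hx0p : 0 < x₀ := hξ0.trans_le hx₀
    have hxm : x ∈ Set.Icc ξ 1 := ⟨hx₀.trans hx.1, hx.2⟩
    have hneg : deriv v x ≤ 0 := by
      rw [← hd1]; exact hdm hxm ⟨hξ1.le, le_rfl⟩ hx.2
    have hv0 : v x₀ ≤ (Real.sqrt x₀)⁻¹ := by
      rw [← Real.sqrt_inv]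
      apply Real.le_sqrt_of_sq_le
      simpa using hi x₀ ⟨hx0p, hx01⟩
    rw [abs_of_nonpos hneg]
    refine le_trans ?_ hv0
    rcases hx.1.eq_or_lt with h | h
    · subst h
      have := hpos x₀ ⟨hx0p.le, hx01⟩
      simpa using this.le
    · obtain ⟨y, hy, hye⟩ := exists_deriv_eq_slope v h hcont.continuousOn hdiff.differentiableOn
      rw [eq_div_iff (sub_pos.2 h).ne'] at hye
      have h1 : deriv v y ≤ deriv v x :=
        hdm ⟨hx₀.trans hy.1.le, hy.2.le.trans hx.2⟩ hxm hy.2.le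
      have h2 := hpos x ⟨hx0p.le.trans hx.1, hx.2⟩
      have h3 := mul_le_mul_of_nonneg_right h1 (sub_pos.2 h).le
      linarith

theorem stmt_15 (ν Cg l₁ l₂ : ℝ) (g₁ g₂ v₁ v₂ : ℝ → ℝ) (ξ₁ ξ₂ : ℝ)
    (hν : 0 < ν) (hCg : 0 < Cg) (hg₁ : GAss Cg g₁) (hg₂ : GAss Cg g₂)
    (hsol : IsSolution ν g₁ g₂ v₁ v₂ l₁ l₂)
    (hmono₁ : AntitoneOn v₁ (Set.Icc 0 1)) (hmono₂ : MonotoneOn v₂ (Set.Icc 0 1))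
    (hξ₁ : ξ₁ ∈ Set.Ioo (0:ℝ) 1) (hξ₂ : ξ₂ ∈ Set.Ioo (0:ℝ) 1)
    (hinfl₁ : deriv (deriv v₁) ξ₁ = 0) (hinfl₂ : deriv (deriv v₂) ξ₂ = 0) :
    (∀ x ∈ Set.Ioc (0:ℝ) 1, (v₁ x) ^ 2 ≤ 1 / x) ∧
    (∀ x ∈ Set.Ico (0:ℝ) 1, (v₂ x) ^ 2 ≤ 1 / (1 - x)) ∧
    ξ₁ * ((v₁ 0) ^ 2 + v₁ 0 * v₁ ξ₁ + (v₁ ξ₁) ^ 2) ≤ 3 ∧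
    (1 - ξ₂) * ((v₂ 1) ^ 2 + v₂ 1 * v₂ ξ₂ + (v₂ ξ₂) ^ 2) ≤ 3 ∧
    (∀ x₀ : ℝ, ξ₁ ≤ x₀ → ∀ x ∈ Set.Icc x₀ 1,
      |deriv v₁ x| * (x - x₀) ≤ (Real.sqrt x₀)⁻¹) ∧
    (∀ x₀ : ℝ, x₀ ≤ ξ₂ → ∀ x ∈ Set.Icc 0 x₀,
      |deriv v₂ x| * (x₀ - x) ≤ (Real.sqrt (1 - x₀))⁻¹) := by
  obtain ⟨hv₁, hv₂, ho₁, ho₂, hp₁, hp₂, hd10, hd11, hd20, hd21, hi₁, hi₂⟩ := hsol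
  have A := core_bounds v₁ (fun x => (g₁ ((v₂ x) ^ 2) - l₁) / ν) ξ₁ hv₁
    (fun x hx => by
      have := ho₁ x hx
      field_simp
      linarith)
    (fun x hx y hy hxy => by
      have h1 := pow_le_pow_left₀ (hp₂ x hx).le (hmono₂ hx hy hxy) 2
      have h2 := hg₁.2.1.monotoneOn (Set.mem_Ici.2 (sq_nonneg (v₂ x)))
        (Set.mem_Ici.2 (sq_nonneg (v₂ y))) h1
      exact div_le_div_of_nonneg_right (by linarith) hν.le)
    hp₁ hd11 hi₁ hmono₁ hξ₁ hinfl₁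
  have hm : ∀ x ∈ Set.Icc (0:ℝ) 1, 1 - x ∈ Set.Icc (0:ℝ) 1 :=
    fun x hx => ⟨by linarith [hx.2], by linarith [hx.1]⟩
  have hw1 : deriv (fun x => v₂ (1 - x)) = fun x => - deriv v₂ (1 - x) := by
    funext x; exact deriv_comp_const_sub v₂ 1 x
  have hw2 : deriv (deriv (fun x => v₂ (1 - x))) = fun x => deriv (deriv v₂) (1 - x) := by
    rw [hw1]; funext x
    rw [deriv.fun_neg, deriv_comp_const_sub (deriv v₂) 1 x, neg_neg]
  have B := core_bounds (fun x => v₂ (1 - x)) (fun x => (g₂ ((v₁ (1 - x)) ^ 2) - l₂) / ν) (1 - ξ₂)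
    (hv₂.comp (contDiff_const.sub contDiff_id))
    (fun x hx => by
      have := ho₂ (1 - x) (hm x hx)
      rw [hw2]
      field_simp
      linarith)
    (fun x hx y hy hxy => by
      have h1 := pow_le_pow_left₀ (hp₁ _ (hm x hx)).le
        (hmono₁ (hm y hy) (hm x hx) (sub_le_sub_left hxy 1)) 2
      have h2 := hg₂.2.1.monotoneOn (Set.mem_Ici.2 (sq_nonneg (v₁ (1 - x))))
        (Set.mem_Ici.2 (sq_nonneg (v₁ (1 - y)))) h1
      exact div_le_div_of_nonneg_right (by linarith) hν.le)
    (fun x hx => hp₂ _ (hm x hx))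
    (by rw [hw1]; simp [hd20])
    (by
      rw [intervalIntegral.integral_comp_sub_left (fun x => (v₂ x) ^ 2) 1]
      simpa using hi₂)
    (fun x hx y hy hxy => hmono₂ (hm y hy) (hm x hx) (sub_le_sub_left hxy 1))
    ⟨by linarith [hξ₂.2], by linarith [hξ₂.1]⟩
    (by rw [hw2]; simpa using hinfl₂)
  obtain ⟨a1, a2, a3⟩ := A
  obtain ⟨b1, b2, b3⟩ := B
  refine ⟨a1, ?_, a2, ?_, a3, ?_⟩
  · intro x hx
    have := b1 (1 - x) ⟨by linarith [hx.2], by linarith [hx.1]⟩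
    simpa using this
  · simpa using b2
  · intro x₀ hx₀ x hx
    have := b3 (1 - x₀) (by linarith) (1 - x) ⟨by linarith [hx.2], by linarith [hx.1]⟩
    rw [hw1] at this
    simpa using this
end

section
/- Let (v₁,v₂,λ₁,λ₂) be a monotone solution of the one-dimensional system with viscosity ν (v₁ decreasing, v₂ increasing). Then for each i ∈ {1,2}: (i) |v_i(0)² − v_i(1)²| ≤ 2λ_i/ν; (ii) ν·(sup_{[0,1]} |v_i'|)² ≤ λ_i·(sup_{[0,1]} v_i)². -/
open Set Filter MeasureTheory

theorem aux_core (ν l : ℝ) (a v : ℝ → ℝ) (hν : 0 < ν) (hv : ContDiff ℝ 2 v)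
    (ha : ∀ x ∈ Set.Icc (0:ℝ) 1, 0 ≤ a x)
    (hode : ∀ x ∈ Set.Icc (0:ℝ) 1, -ν * deriv (deriv v) x + a x * v x = l * v x)
    (hpos : ∀ x ∈ Set.Icc (0:ℝ) 1, 0 < v x)
    (h0 : deriv v 0 = 0) (h1 : deriv v 1 = 0)
    (hint : (∫ x in (0:ℝ)..1, (v x) ^ 2) = 1)
    (hmono : AntitoneOn v (Set.Icc 0 1)) :
    |(v 0) ^ 2 - (v 1) ^ 2| ≤ 2 * l / ν ∧ 0 ≤ l ∧
      ∀ x ∈ Set.Icc (0:ℝ) 1, ν * (deriv v x) ^ 2 ≤ l * (v 0) ^ 2 := by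
  have m0 : (0:ℝ) ∈ Set.Icc (0:ℝ) 1 := by simp
  have m1 : (1:ℝ) ∈ Set.Icc (0:ℝ) 1 := by simp
  have hd : ∀ x, HasDerivAt v (deriv v x) x := fun x =>
    (hv.differentiable (by norm_num) x).hasDerivAt
  have hv' : ContDiff ℝ 1 (deriv v) := by
    have : ContDiff ℝ (1+1) v := by simpa [one_add_one_eq_two] using hv
    exact (contDiff_succ_iff_deriv.1 this).2.2
  have hdd : ∀ x, HasDerivAt (deriv v) (deriv (deriv v) x) x := fun x =>
    (hv'.differentiable (by norm_num) x).hasDerivAt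
  have hc : Continuous v := hv.continuous
  have mono : ∀ f f' : ℝ → ℝ, (∀ x, HasDerivAt f (f' x) x) →
      (∀ x ∈ Set.Ioo (0:ℝ) 1, 0 ≤ f' x) → MonotoneOn f (Set.Icc 0 1) := by
    intro f f' hf hf'
    refine monotoneOn_of_deriv_nonneg (convex_Icc 0 1)
      (fun x _ => (hf x).continuousAt.continuousWithinAt)
      (fun x _ => (hf x).differentiableAt.differentiableWithinAt) ?_
    intro x hx
    rw [interior_Icc] at hx
    rw [(hf x).deriv]; exact hf' x hx
  have hneg : ∀ x ∈ Set.Ioo (0:ℝ) 1, deriv v x ≤ 0 := by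
    intro x hx
    have := hmono.derivWithin_nonpos (x := x)
    rwa [derivWithin_of_mem_nhds (Icc_mem_nhds hx.1 hx.2)] at this
  have hV : ∀ x, HasDerivAt (fun y => ∫ t in (0:ℝ)..y, v t) (v x) x := fun x =>
    intervalIntegral.integral_hasDerivAt_right (hc.intervalIntegrable _ _)
      (hc.stronglyMeasurableAtFilter _ _) hc.continuousAt
  set V : ℝ → ℝ := fun y => ∫ t in (0:ℝ)..y, v t with hVdef
  have V0 : V 0 = 0 := by simp [hVdef]
  have hA := mono (fun x => ν * deriv v x + l * V x) _
    (fun x => ((hdd x).const_mul ν).add ((hV x).const_mul l)) (by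
      intro x hx
      have hx' := Ioo_subset_Icc_self hx
      have := hode x hx'
      have := mul_nonneg (ha x hx') (hpos x hx').le
      linarith)
  have hA0 : ∀ x ∈ Set.Icc (0:ℝ) 1, 0 ≤ ν * deriv v x + l * V x := by
    intro x hx
    have := hA m0 hx hx.1
    simpa [h0, V0] using this
  have V1pos : 0 < V 1 :=
    intervalIntegral.intervalIntegral_pos_of_pos_on (hc.intervalIntegrable _ _)
      (fun x hx => hpos x (Ioo_subset_Icc_self hx)) one_pos
  have hl : 0 ≤ l := by
    have := hA0 1 m1
    rw [h1] at this
    by_contra hcon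
    push Not at hcon
    nlinarith
  have V1le : V 1 ^ 2 ≤ 1 := by
    have e : (∫ x in (0:ℝ)..1, (v x - V 1) ^ 2) = 1 - V 1 ^ 2 := by
      have : ∀ x, (v x - V 1) ^ 2 = (v x) ^ 2 - (2 * V 1) * v x + V 1 ^ 2 := by
        intro x; ring
      simp_rw [this]
      rw [intervalIntegral.integral_add, intervalIntegral.integral_sub,
        intervalIntegral.integral_const_mul, hint]
      · have : (∫ x in (0:ℝ)..1, v x) = V 1 := rfl
        rw [this]; simp; ring
      all_goals exact Continuous.intervalIntegrable (by fun_prop) _ _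
    have : 0 ≤ ∫ x in (0:ℝ)..1, (v x - V 1) ^ 2 :=
      intervalIntegral.integral_nonneg zero_le_one (fun x _ => sq_nonneg _)
    linarith
  have hB := mono (fun x => ν * v x ^ 2 + l * V x ^ 2) _
    (fun x => (((hd x).pow 2).const_mul ν).add (((hV x).pow 2).const_mul l)) (by
      intro x hx
      have hx' := Ioo_subset_Icc_self hx
      have := mul_nonneg (hA0 x hx') (hpos x hx').le
      norm_num
      nlinarith) m0 m1 zero_le_one
  simp only [V0] at hB
  have hC := mono (fun x => -(ν * deriv v x ^ 2 + l * v x ^ 2)) _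
    (fun x => ((((hdd x).pow 2).const_mul ν).add (((hd x).pow 2).const_mul l)).neg) (by
      intro x hx
      have hx' := Ioo_subset_Icc_self hx
      have e := hode x hx'
      have e2 : ν * deriv (deriv v) x + l * v x = a x * v x := by linarith
      have := mul_nonneg (mul_nonneg (ha x hx') (hpos x hx').le)
        (neg_nonneg.2 (hneg x hx))
      rw [← e2] at this
      norm_num
      nlinarith)
  refine ⟨?_, hl, ?_⟩
  · have h01 := hmono m0 m1 zero_le_one
    have p1 := hpos 1 m1
    rw [abs_of_nonneg (by nlinarith), le_div_iff₀ hν]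
    nlinarith
  · intro x hx
    have := hC m0 hx hx.1
    simp only [h0] at this
    nlinarith [mul_nonneg hl (sq_nonneg (v x))]

theorem aux_sup (ν l p : ℝ) (v : ℝ → ℝ) (hv : ContDiff ℝ 2 v) (hl : 0 ≤ l)
    (hp : p ∈ Set.Icc (0:ℝ) 1) (hvp : 0 < v p)
    (h : ∀ x ∈ Set.Icc (0:ℝ) 1, ν * (deriv v x) ^ 2 ≤ l * (v p) ^ 2) :
    ν * (sSup ((fun x => |deriv v x|) '' Set.Icc (0:ℝ) 1)) ^ 2
      ≤ l * (sSup ((fun x => v x) '' Set.Icc (0:ℝ) 1)) ^ 2 := by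
  have hc' : Continuous (deriv v) := hv.continuous_deriv (by norm_num)
  obtain ⟨x, hx, hxe⟩ := isCompact_Icc.exists_sSup_image_eq (s := Set.Icc (0:ℝ) 1) ⟨p, hp⟩
    (f := fun x => |deriv v x|) (by fun_prop)
  rw [hxe]
  simp only [sq_abs]
  refine (h x hx).trans ?_
  have : v p ≤ sSup ((fun x => v x) '' Set.Icc (0:ℝ) 1) :=
    le_csSup (isCompact_Icc.bddAbove_image hv.continuous.continuousOn) ⟨p, hp, rfl⟩
  gcongr

theorem stmt_17 (ν Cg l₁ l₂ : ℝ) (g₁ g₂ v₁ v₂ : ℝ → ℝ)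
    (hν : 0 < ν) (hCg : 0 < Cg) (hg₁ : GAss Cg g₁) (hg₂ : GAss Cg g₂)
    (hsol : IsSolution ν g₁ g₂ v₁ v₂ l₁ l₂)
    (hmono₁ : AntitoneOn v₁ (Set.Icc 0 1)) (hmono₂ : MonotoneOn v₂ (Set.Icc 0 1)) :
    |(v₁ 0) ^ 2 - (v₁ 1) ^ 2| ≤ 2 * l₁ / ν ∧
    |(v₂ 0) ^ 2 - (v₂ 1) ^ 2| ≤ 2 * l₂ / ν ∧
    ν * (sSup ((fun x => |deriv v₁ x|) '' Set.Icc (0:ℝ) 1)) ^ 2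
      ≤ l₁ * (sSup ((fun x => v₁ x) '' Set.Icc (0:ℝ) 1)) ^ 2 ∧
    ν * (sSup ((fun x => |deriv v₂ x|) '' Set.Icc (0:ℝ) 1)) ^ 2
      ≤ l₂ * (sSup ((fun x => v₂ x) '' Set.Icc (0:ℝ) 1)) ^ 2 := by
  obtain ⟨c1, c2, o1, o2, p1, p2, d10, d11, d20, d21, i1, i2⟩ := hsol
  have m0 : (0:ℝ) ∈ Set.Icc (0:ℝ) 1 := by simp
  have m1 : (1:ℝ) ∈ Set.Icc (0:ℝ) 1 := by simp
  have gn : ∀ g, GAss Cg g → ∀ s : ℝ, 0 ≤ g (s ^ 2) := fun g hg s =>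
    le_trans (by positivity) (hg.2.2 _ (sq_nonneg s)).1
  have mr : ∀ x ∈ Set.Icc (0:ℝ) 1, 1 - x ∈ Set.Icc (0:ℝ) 1 := fun x hx =>
    ⟨by linarith [hx.2], by linarith [hx.1]⟩
  obtain ⟨A1, L1, B1⟩ := aux_core ν l₁ (fun x => g₁ (v₂ x ^ 2)) v₁ hν c1
    (fun x _ => gn g₁ hg₁ _) o1 p1 d10 d11 i1 hmono₁
  have e1 : deriv (fun x => v₂ (1 - x)) = fun x => -deriv v₂ (1 - x) := by
    funext x; exact deriv_comp_const_sub _ _ _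
  have e2 : deriv (deriv (fun x => v₂ (1 - x))) = fun x => deriv (deriv v₂) (1 - x) := by
    rw [e1]; funext x
    rw [deriv.fun_neg, deriv_comp_const_sub, neg_neg]
  obtain ⟨A2, L2, B2⟩ := aux_core ν l₂ (fun x => g₂ (v₁ (1 - x) ^ 2)) (fun x => v₂ (1 - x)) hν
    (c2.comp (contDiff_const.sub contDiff_id))
    (fun x _ => gn g₂ hg₂ _) (fun x hx => by rw [e2]; exact o2 _ (mr x hx))
    (fun x hx => p2 _ (mr x hx)) (by rw [e1]; simp [d21]) (by rw [e1]; simp [d20])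
    (by rw [intervalIntegral.integral_comp_sub_left (fun x => v₂ x ^ 2)]; simpa using i2)
    (fun x hx y hy hxy => hmono₂ (mr y hy) (mr x hx) (by linarith))
  refine ⟨A1, ?_, aux_sup ν l₁ 0 v₁ c1 L1 m0 (p1 0 m0) B1,
    aux_sup ν l₂ 1 v₂ c2 L2 m1 (p2 1 m1) ?_⟩
  · rw [abs_sub_comm]; simpa using A2
  · intro x hx
    have := B2 _ (mr x hx)
    rw [e1] at this
    simpa using this
end

section
/- Let (ν_n, v_{1,n}, v_{2,n}, λ_{1,n}, λ_{2,n}) be a sequence of monotone solutions of the one-dimensional system (v_{1,n} decreasing, v_{2,n} increasing) with ν_n → 0. Suppose that for some i ∈ {1,2} (j = 3−i) one has ‖v_{i,n}‖_∞ ≤ C for all n and λ_{j,n} → 0 as n → ∞. Then there exists a constant C' > 0, independent of n, such that λ_{i,n} ≤ C' ν_n for all sufficiently large n. -/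
open Set Filter MeasureTheory

lemma taylor_lower (f : ℝ → ℝ) (hf : ContDiff ℝ 2 f) (p q m : ℝ) (hpq : p ≤ q)
    (h0 : 0 ≤ deriv f p) (h2 : ∀ x ∈ Icc p q, m ≤ deriv (deriv f) x) :
    f p + m * (q - p) ^ 2 / 2 ≤ f q := by
  have hd : Differentiable ℝ f := hf.differentiable (by norm_num)
  have hf1 : ContDiff ℝ 1 (deriv f) := by
    have : ContDiff ℝ (1 + 1) f := by simpa [one_add_one_eq_two] using hf
    exact (contDiff_succ_iff_deriv.1 this).2.2
  have hd1 : Differentiable ℝ (deriv f) := hf1.differentiable (by norm_num)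
  have key1 : MonotoneOn (fun x => deriv f x - m * (x - p)) (Icc p q) := by
    have hder : ∀ x, HasDerivAt (fun x => deriv f x - m * (x - p)) (deriv (deriv f) x - m) x := by
      intro x
      have h := (hd1 x).hasDerivAt.fun_sub (((hasDerivAt_id' x).sub_const p).const_mul m)
      rw [mul_one] at h
      exact h
    apply monotoneOn_of_deriv_nonneg (convex_Icc p q)
    · exact fun x _ => (hder x).continuousAt.continuousWithinAt
    · exact fun x _ => (hder x).differentiableAt.differentiableWithinAt
    · intro x hx
      rw [(hder x).deriv]
      linarith [h2 x (interior_subset hx)]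
  have key2 : MonotoneOn (fun x => f x - m * (x - p) ^ 2 / 2) (Icc p q) := by
    have hder : ∀ x, HasDerivAt (fun x => f x - m * (x - p) ^ 2 / 2)
        (deriv f x - m * (x - p)) x := by
      intro x
      have h := (hd x).hasDerivAt.fun_sub
        (((((hasDerivAt_id' x).sub_const p).fun_pow 2).const_mul m).div_const 2)
      refine h.congr_deriv ?_
      norm_num
      ring
    apply monotoneOn_of_deriv_nonneg (convex_Icc p q)
    · exact fun x _ => (hder x).continuousAt.continuousWithinAt
    · exact fun x _ => (hder x).differentiableAt.differentiableWithinAt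
    · intro x hx
      rw [(hder x).deriv]
      have hx' := interior_subset hx
      have := key1 (left_mem_Icc.2 hpq) hx' hx'.1
      simp at this
      linarith
  have := key2 (left_mem_Icc.2 hpq) (right_mem_Icc.2 hpq) hpq
  simp at this
  linarith

set_option maxHeartbeats 2000000 in
lemma core (Cg C : ℝ) (hCg : 0 < Cg) (hC : 1 ≤ C) :
    ∃ C' > 0, ∀ (g₁ g₂ v₁ v₂ : ℝ → ℝ) (ν l₁ l₂ : ℝ), GAss Cg g₁ → GAss Cg g₂ →
      0 < ν → ν ≤ 1 → l₂ ≤ Cg⁻¹ / 4 → IsSolution ν g₁ g₂ v₁ v₂ l₁ l₂ →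
      AntitoneOn v₁ (Icc 0 1) → MonotoneOn v₂ (Icc 0 1) →
      (∀ x ∈ Icc (0:ℝ) 1, |v₁ x| ≤ C) → l₁ ≤ C' * ν := by
  obtain ⟨a, ha⟩ : ∃ a : ℝ, a = 1 / (2 * C ^ 2) := ⟨_, rfl⟩
  have hC2 : 1 ≤ C ^ 2 := by nlinarith
  have ha0 : 0 < a := by rw [ha]; positivity
  have ha1 : a ≤ 1 / 2 := by
    rw [ha]; apply one_div_le_one_div_of_le <;> linarith
  have haC : C ^ 2 * a = 1 / 2 := by rw [ha]; field_simp
  obtain ⟨b, hb⟩ : ∃ b : ℝ, b = a / 2 := ⟨_, rfl⟩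
  have hb0 : 0 < b := by linarith
  obtain ⟨M, hM⟩ : ∃ M : ℝ, M = 16 * Cg / b ^ 2 := ⟨_, rfl⟩
  have hM0 : 0 < M := by rw [hM]; positivity
  have hMb : M * b ^ 2 = 16 * Cg := by rw [hM]; field_simp
  obtain ⟨μ, hμ⟩ : ∃ μ : ℝ, μ = 4 * C / b ^ 2 := ⟨_, rfl⟩
  have hμ0 : 0 < μ := by rw [hμ]; positivity
  have hμb : μ * b ^ 2 = 4 * C := by rw [hμ]; field_simp
  refine ⟨Cg * M ^ 2 + μ, by positivity, ?_⟩
  intro g₁ g₂ v₁ v₂ ν l₁ l₂ hg₁ hg₂ hν hν1 hl₂ hsol hm₁ hm₂ hbd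
  obtain ⟨hc₁, hc₂, e₁, e₂, p₁, p₂, n₁, -, -, -, i₁, i₂⟩ := hsol
  have ma : a ∈ Icc (0:ℝ) 1 := ⟨ha0.le, by linarith⟩
  have mb : b ∈ Icc (0:ℝ) 1 := ⟨hb0.le, by linarith⟩
  have m0 : (0:ℝ) ∈ Icc (0:ℝ) 1 := ⟨le_rfl, zero_le_one⟩
  have ii₁ : ∀ x y : ℝ, IntervalIntegrable (fun x => v₁ x ^ 2) volume x y :=
    fun x y => (hc₁.continuous.pow 2).intervalIntegrable x y
  have ii₂ : ∀ x y : ℝ, IntervalIntegrable (fun x => v₂ x ^ 2) volume x y :=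
    fun x y => (hc₂.continuous.pow 2).intervalIntegrable x y
  -- lower bound for v₁ at a
  have hv1a : 1 / 2 ≤ v₁ a ^ 2 := by
    have hs := intervalIntegral.integral_add_adjacent_intervals (ii₁ 0 a) (ii₁ a 1)
    have h1 : ∫ x in (0:ℝ)..a, v₁ x ^ 2 ≤ ∫ x in (0:ℝ)..a, C ^ 2 := by
      apply intervalIntegral.integral_mono_on ha0.le (ii₁ _ _) (by simp)
      intro x hx
      exact sq_le_sq' (by linarith [(abs_le.1 (hbd x ⟨hx.1, hx.2.trans ma.2⟩)).1])
        (abs_le.1 (hbd x ⟨hx.1, hx.2.trans ma.2⟩)).2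
    have h2 : ∫ x in a..1, v₁ x ^ 2 ≤ ∫ x in a..1, v₁ a ^ 2 := by
      apply intervalIntegral.integral_mono_on ma.2 (ii₁ _ _) (by simp)
      intro x hx
      have mx : x ∈ Icc (0:ℝ) 1 := ⟨ha0.le.trans hx.1, hx.2⟩
      have := hm₁ ma mx hx.1
      have := p₁ x mx
      gcongr
    simp at h1 h2
    rw [i₁] at hs
    have := p₁ a ma
    nlinarith [sq_nonneg (v₁ a)]
  have hv1 : ∀ x ∈ Icc 0 a, 1 / 2 ≤ v₁ x ^ 2 ∧ 1 / 2 ≤ v₁ x := by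
    intro x hx
    have h1 := hm₁ ⟨hx.1, hx.2.trans ma.2⟩ ma hx.2
    have h2 := p₁ a ma
    have h3 : v₁ a ^ 2 ≤ v₁ x ^ 2 := by gcongr
    exact ⟨hv1a.trans h3, by nlinarith⟩
  -- upper bound for v₂ at a
  have hv2a : v₂ a ≤ 2 := by
    have hs := intervalIntegral.integral_add_adjacent_intervals (ii₂ 0 a) (ii₂ a 1)
    have h1 : 0 ≤ ∫ x in (0:ℝ)..a, v₂ x ^ 2 :=
      intervalIntegral.integral_nonneg ha0.le (fun x _ => sq_nonneg _)
    have h2 : ∫ x in a..1, v₂ a ^ 2 ≤ ∫ x in a..1, v₂ x ^ 2 := by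
      apply intervalIntegral.integral_mono_on ma.2 (by simp) (ii₂ _ _)
      intro x hx
      have mx : x ∈ Icc (0:ℝ) 1 := ⟨ha0.le.trans hx.1, hx.2⟩
      have := hm₂ ma mx hx.1
      have := p₂ a ma
      gcongr
    simp at h2
    rw [i₂] at hs
    by_contra hlt
    push Not at hlt
    nlinarith
  have hCgi : 0 < Cg⁻¹ := by positivity
  have hCgm : Cg⁻¹ * Cg = 1 := inv_mul_cancel₀ hCg.ne'
  -- v₂ is small on [0,b]
  have hv2b : v₂ b ≤ M * ν := by
    have hd0 : 0 ≤ deriv v₂ b := by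
      have h := hm₂.derivWithin_nonneg (x := b)
      rwa [derivWithin_of_mem_nhds (Icc_mem_nhds hb0 (by linarith))] at h
    have h2 := taylor_lower v₂ hc₂ b a (Cg⁻¹ / 4 * v₂ b / ν) (by linarith) hd0 (by
      intro x hx
      have mx : x ∈ Icc (0:ℝ) 1 := ⟨hb0.le.trans hx.1, hx.2.trans ma.2⟩
      rw [div_le_iff₀ hν]
      have e := e₂ x mx
      have g := (hg₂.2.2 (v₁ x ^ 2) (sq_nonneg _)).1
      have h1 := (hv1 x ⟨mx.1, hx.2⟩).1
      have hm := hm₂ mb mx hx.1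
      have hp := p₂ b mb
      have h3 : Cg⁻¹ / 4 ≤ g₂ (v₁ x ^ 2) - l₂ := by nlinarith
      have h4 := mul_le_mul h3 hm hp.le (by linarith)
      nlinarith)
    have hp := p₂ b mb
    have hab : a - b = b := by linarith
    rw [hab] at h2
    have h3 : Cg⁻¹ / 4 * v₂ b / ν * b ^ 2 / 2 ≤ 2 := by linarith
    have h4 : Cg⁻¹ / 4 * v₂ b / ν * b ^ 2 / 2 = v₂ b * b ^ 2 / (8 * Cg * ν) := by
      field_simp; norm_num
    rw [h4, div_le_iff₀ (by positivity)] at h3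
    have hb2 : 0 < b ^ 2 := by positivity
    have : v₂ b * b ^ 2 ≤ (M * ν) * b ^ 2 := by nlinarith
    exact le_of_mul_le_mul_right this hb2
  by_contra hl
  push Not at hl
  have h1 := taylor_lower (fun x => - v₁ x) hc₁.neg 0 b (μ / 2) hb0.le
    (by simp [n₁]) (by
      intro x hx
      have mx : x ∈ Icc (0:ℝ) 1 := ⟨hx.1, hx.2.trans mb.2⟩
      have hdd : deriv (deriv (fun x => - v₁ x)) x = - deriv (deriv v₁) x := by
        have : deriv (fun x => - v₁ x) = fun x => - deriv v₁ x := by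
          funext y; exact deriv.fun_neg
        rw [this]; exact deriv.fun_neg
      rw [hdd]
      have e := e₁ x mx
      have g := (hg₁.2.2 (v₂ x ^ 2) (sq_nonneg _)).2
      have hv := (hv1 x ⟨mx.1, by linarith [hx.2]⟩).2
      have hm := hm₂ mx mb hx.2
      have hp := p₂ x mx
      have h3 : v₂ x ^ 2 ≤ (M * ν) ^ 2 := by
        have := hm.trans hv2b
        gcongr
      have h4 : (M * ν) ^ 2 ≤ M ^ 2 * ν := by
        have : ν ^ 2 ≤ ν := by nlinarith
        have := mul_le_mul_of_nonneg_left this (sq_nonneg M)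
        nlinarith
      have h5 : g₁ (v₂ x ^ 2) ≤ Cg * (M ^ 2 * ν) :=
        g.trans (mul_le_mul_of_nonneg_left (h3.trans h4) hCg.le)
      have h6 : μ * ν ≤ l₁ - g₁ (v₂ x ^ 2) := by linarith
      have h7 := mul_le_mul h6 hv (by norm_num) ((mul_pos hμ0 hν).le.trans h6)
      have h8 : (μ / 2) * ν ≤ (- deriv (deriv v₁) x) * ν := by linarith
      exact le_of_mul_le_mul_right h8 hν)
  simp only [sub_zero] at h1
  have h2 := (abs_le.1 (hbd 0 m0)).2
  have h3 := p₁ b mb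
  linarith

lemma deriv_refl (f : ℝ → ℝ) : deriv (fun x => f (1 - x)) = fun x => - deriv f (1 - x) := by
  funext x
  exact deriv_comp_const_sub ..

lemma deriv2_refl (f : ℝ → ℝ) (x : ℝ) :
    deriv (deriv (fun x => f (1 - x))) x = deriv (deriv f) (1 - x) := by
  rw [deriv_refl]
  have : deriv (fun x => - deriv f (1 - x)) x = - deriv (fun x => deriv f (1 - x)) x :=
    deriv.fun_neg
  rw [this, deriv_refl]
  simp

lemma refl_sol {ν : ℝ} {g₁ g₂ v₁ v₂ : ℝ → ℝ} {l₁ l₂ : ℝ}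
    (h : IsSolution ν g₁ g₂ v₁ v₂ l₁ l₂) :
    IsSolution ν g₂ g₁ (fun x => v₂ (1 - x)) (fun x => v₁ (1 - x)) l₂ l₁ := by
  obtain ⟨hc₁, hc₂, e₁, e₂, p₁, p₂, n₁, n₁', n₂, n₂', i₁, i₂⟩ := h
  have hm : ∀ x ∈ Icc (0:ℝ) 1, 1 - x ∈ Icc (0:ℝ) 1 :=
    fun x hx => ⟨by linarith [hx.2], by linarith [hx.1]⟩
  refine ⟨hc₂.comp (contDiff_const.sub contDiff_id), hc₁.comp (contDiff_const.sub contDiff_id),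
    ?_, ?_, fun x hx => p₂ _ (hm x hx), fun x hx => p₁ _ (hm x hx), ?_, ?_, ?_, ?_, ?_, ?_⟩
  · intro x hx
    rw [deriv2_refl]
    exact e₂ _ (hm x hx)
  · intro x hx
    rw [deriv2_refl]
    exact e₁ _ (hm x hx)
  · simp [deriv_refl, n₂']
  · simp [deriv_refl, n₂]
  · simp [deriv_refl, n₁']
  · simp [deriv_refl, n₁]
  · rw [intervalIntegral.integral_comp_sub_left (fun x => v₂ x ^ 2)]; simpa using i₂
  · rw [intervalIntegral.integral_comp_sub_left (fun x => v₁ x ^ 2)]; simpa using i₁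

theorem stmt_18 (Cg C : ℝ) (g₁ g₂ : ℝ → ℝ)
    (ν l₁ l₂ : ℕ → ℝ) (v₁ v₂ : ℕ → ℝ → ℝ)
    (hCg : 0 < Cg) (hg₁ : GAss Cg g₁) (hg₂ : GAss Cg g₂)
    (hν : ∀ n, 0 < ν n)
    (hsol : ∀ n, IsSolution (ν n) g₁ g₂ (v₁ n) (v₂ n) (l₁ n) (l₂ n))
    (hmono : ∀ n, AntitoneOn (v₁ n) (Set.Icc 0 1) ∧ MonotoneOn (v₂ n) (Set.Icc 0 1))
    (hν0 : Tendsto ν atTop (nhds 0)) :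
    ((∀ n, ∀ x ∈ Set.Icc (0:ℝ) 1, |v₁ n x| ≤ C) → Tendsto l₂ atTop (nhds 0) →
      ∃ C' > 0, ∀ᶠ n in atTop, l₁ n ≤ C' * ν n) ∧
    ((∀ n, ∀ x ∈ Set.Icc (0:ℝ) 1, |v₂ n x| ≤ C) → Tendsto l₁ atTop (nhds 0) →
      ∃ C' > 0, ∀ᶠ n in atTop, l₂ n ≤ C' * ν n) := by
  constructor
  · intro hbd hl
    obtain ⟨C', hC', H⟩ := core Cg (max C 1) hCg (le_max_right _ _)
    refine ⟨C', hC', ?_⟩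
    filter_upwards [hν0.eventually_le_const one_pos,
      hl.eventually_le_const (show 0 < Cg⁻¹ / 4 by positivity)] with n h1 h2
    exact H g₁ g₂ (v₁ n) (v₂ n) (ν n) (l₁ n) (l₂ n) hg₁ hg₂ (hν n) h1 h2 (hsol n)
      (hmono n).1 (hmono n).2 (fun x hx => (hbd n x hx).trans (le_max_left _ _))
  · intro hbd hl
    obtain ⟨C', hC', H⟩ := core Cg (max C 1) hCg (le_max_right _ _)
    refine ⟨C', hC', ?_⟩
    have hm : ∀ x ∈ Icc (0:ℝ) 1, 1 - x ∈ Icc (0:ℝ) 1 :=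
      fun x hx => ⟨by linarith [hx.2], by linarith [hx.1]⟩
    filter_upwards [hν0.eventually_le_const one_pos,
      hl.eventually_le_const (show 0 < Cg⁻¹ / 4 by positivity)] with n h1 h2
    exact H g₂ g₁ _ _ (ν n) (l₂ n) (l₁ n) hg₂ hg₁ (hν n) h1 h2 (refl_sol (hsol n))
      (fun x hx y hy hxy => (hmono n).2 (hm y hy) (hm x hx) (by linarith))
      (fun x hx y hy hxy => (hmono n).1 (hm y hy) (hm x hx) (by linarith))
      (fun x hx => (hbd n _ (hm x hx)).trans (le_max_left _ _))
end
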